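/- arXiv:1907.09577 — 8 statements merged into one kernel-verified Lean document; each statement's English description precedes it below -/
import Mathlib

section
/- Every nonempty graph in the class K contains a vertex that is not determined; that is, if G ∈ K is a finite graph with at least one vertex, then there exists a vertex v of G such that no neighbor w of v has label ℓ(w) = ℓ(v)+1 or ℓ(w) = ℓ(v)+2 (addition in ℤ/5ℤ). -/
/-- The class `K`: finite simple graphs with vertices labeled by `ℤ/5ℤ` which are
acyclic and in which no vertex `v` has two neighbors labeled `ℓ v + 1` and `ℓ v + 2`. -/
def inK {V : Type} (G : SimpleGraph V) (ℓ : V → ZMod 5) : Prop :=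
  Finite V ∧ G.IsAcyclic ∧
    ∀ v w₁ w₂ : V, G.Adj v w₁ → G.Adj v w₂ → ℓ w₁ = ℓ v + 1 → ℓ w₂ = ℓ v + 2 → False

/-- In an acyclic graph, following a choice of neighbors that never backtracks yields
arbitrarily long paths. -/
theorem SimpleGraph.IsAcyclic.exists_isPath_length_of_apply_apply_ne {V : Type*}
    {G : SimpleGraph V} (hG : G.IsAcyclic) {f : V → V} (hadj : ∀ v, G.Adj v (f v))
    (hne : ∀ v, f (f v) ≠ v) (n : ℕ) (v : V) :
    ∃ (u : V) (p : G.Walk v u), p.IsPath ∧ p.length = n + 1 ∧ p.snd = f v := by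
  induction n generalizing v with
  | zero => exact ⟨f v, (hadj v).toWalk, by simp [(hadj v).ne], by simp, by simp⟩
  | succ n ih =>
    obtain ⟨u, p, hp, hlen, hsnd⟩ := ih (f v)
    refine ⟨u, .cons (hadj v) p, hp.cons fun hv => hne v ?_, by simp [hlen], by simp⟩
    rw [← hsnd]
    exact (hG.eq_snd_of_adj_start hp (hadj v).symm hv).symm

/-- Every nonempty graph in `K` has an undetermined vertex. -/
theorem stmt0 {V : Type} (G : SimpleGraph V) (ℓ : V → ZMod 5)
    (hG : inK G ℓ) (hne : Nonempty V) :
    ∃ v : V, ∀ w : V, G.Adj v w → ℓ w ≠ ℓ v + 1 ∧ ℓ w ≠ ℓ v + 2 := by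
  obtain ⟨hfin, hacyclic, -⟩ := hG
  have := Fintype.ofFinite V
  by_contra! hdet
  have hdet' : ∀ v, ∃ w, G.Adj v w ∧ (ℓ w = ℓ v + 1 ∨ ℓ w = ℓ v + 2) := fun v => by
    obtain ⟨w, hw, h⟩ := hdet v
    exact ⟨w, hw, or_iff_not_imp_left.mpr h⟩
  choose f hadj hlabel using hdet'
  have no_return : ∀ a b : ZMod 5, (b = a + 1 ∨ b = a + 2) → ¬(a = b + 1 ∨ a = b + 2) := by
    decide
  have hback : ∀ v, f (f v) ≠ v := fun v hv =>
    no_return _ _ (hlabel v) (by simpa only [hv] using hlabel (f v))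
  obtain ⟨v⟩ := hne
  obtain ⟨u, p, hp, hlen, -⟩ :=
    hacyclic.exists_isPath_length_of_apply_apply_ne hadj hback (Fintype.card V) v
  have := hp.length_lt
  omega
end

section
/- The class K fails the cofinal amalgamation property in the following strong form: for every nonempty H ∈ K and every H' ∈ K containing H as an induced labeled subgraph, there exist X, Y ∈ K and label-preserving graph embeddings f : H' → X and g : H' → Y such that there is no W ∈ K with label-preserving graph embeddings f' : X → W and g' : Y → W satisfying f' ∘ f = g' ∘ g. -/
open SimpleGraph

namespace SimpleGraph

/-- In a nonempty finite forest, a map that moves every vertex to a neighbor must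
traverse some edge in both directions. -/
lemma IsAcyclic.exists_apply_apply_eq {V : Type*} [Finite V] [Nonempty V] {G : SimpleGraph V}
    (hG : G.IsAcyclic) (p : V → V) (hp : ∀ v, G.Adj v (p v)) : ∃ v, p (p v) = v := by
  by_contra! hpp
  have key : ∀ n : ℕ, ∃ (v u : V) (q : G.Walk v u), q.IsPath ∧ q.length = n ∧ p v ≠ q.snd := by
    intro n
    induction n with
    | zero =>
      obtain ⟨v⟩ := ‹Nonempty V›
      exact ⟨v, v, .nil, .nil, rfl, (hp v).ne'⟩
    | succ n ih =>
      obtain ⟨v, u, q, hq, hlen, hsnd⟩ := ih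
      refine ⟨p v, u, .cons (hp v).symm q, ?_, by simp [hlen], by simpa using hpp v⟩
      exact hq.cons fun hmem ↦ hsnd (hG.eq_snd_of_adj_start hq (hp v) hmem)
  have := Fintype.ofFinite V
  obtain ⟨v, u, q, hq, hlen, -⟩ := key (Fintype.card V)
  exact (hlen ▸ hq.length_lt).false

/-- Adding isolated vertices to a forest gives a forest. -/
lemma IsAcyclic.map {V V' : Type*} {G : SimpleGraph V} (hG : G.IsAcyclic) (f : V ↪ V') :
    (G.map f).IsAcyclic := by
  rw [isAcyclic_iff_forall_adj_isBridge] at hG ⊢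
  intro a b hab
  obtain ⟨-, x, y, hxy, rfl, rfl⟩ := hab
  have hbr := hG hxy
  rw [isBridge_iff] at hbr ⊢
  have : Nonempty V := ⟨x⟩
  intro hr
  let r : (G.map f).deleteEdges {s(f x, f y)} →g G.deleteEdges {s(x, y)} :=
    { toFun := Function.invFun f
      map_rel' := by
        intro a b hab
        rw [deleteEdges_adj] at hab
        obtain ⟨⟨-, u, w, huw, rfl, rfl⟩, hne⟩ := hab
        rw [Function.leftInverse_invFun f.injective, Function.leftInverse_invFun f.injective,
          deleteEdges_adj]
        refine ⟨huw, fun h ↦ hne ?_⟩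
        simpa using h }
  have := hr.map r
  simp only [r, RelHom.coeFn_mk, Function.leftInverse_invFun f.injective _] at this
  exact hbr this

/-- The graph `G` with a new vertex `none` whose only neighbor is `v`. -/
def addLeaf {V : Type*} (G : SimpleGraph V) (v : V) : SimpleGraph (Option V) :=
  G.map Function.Embedding.some ⊔ edge none (some v)

section addLeaf

variable {V : Type*} (G : SimpleGraph V) (v : V)

@[simp]
lemma addLeaf_adj_some_some (a b : V) : (G.addLeaf v).Adj (some a) (some b) ↔ G.Adj a b := by
  simpa [addLeaf, edge_adj, map_adj'] using fun h : G.Adj a b ↦ h.ne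

@[simp]
lemma addLeaf_adj_none_left (b : Option V) : (G.addLeaf v).Adj none b ↔ b = some v := by
  cases b <;> simp [addLeaf, edge_adj, map_adj']

@[simp]
lemma addLeaf_adj_none_right (b : Option V) : (G.addLeaf v).Adj b none ↔ b = some v := by
  rw [adj_comm, addLeaf_adj_none_left]

/-- The inclusion of `G` into `G.addLeaf v`. -/
def addLeafEmbedding : G ↪g G.addLeaf v where
  toEmbedding := Function.Embedding.some
  map_rel_iff' := by simp

variable {G}

lemma IsAcyclic.addLeaf (hG : G.IsAcyclic) : (G.addLeaf v).IsAcyclic := by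
  refine (hG.map _).sup_edge_of_not_reachable fun h ↦ ?_
  obtain ⟨w⟩ := h
  cases w with
  | cons h _ => simp [map_adj'] at h

end addLeaf

end SimpleGraph

/-- Attaching a leaf labeled `c` at `v` stays in `K` if it creates no forbidden pair at `v`. -/
lemma inK.addLeaf {V : Type} {G : SimpleGraph V} {ℓ : V → ZMod 5} (hG : inK G ℓ) {v : V}
    (hv : ∀ w, G.Adj v w → ℓ w ≠ ℓ v + 1 ∧ ℓ w ≠ ℓ v + 2) (c : ZMod 5) :
    inK (G.addLeaf v) (fun x ↦ x.elim c ℓ) := by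
  obtain ⟨hfin, hac, hlab⟩ := hG
  refine ⟨inferInstance, hac.addLeaf v, ?_⟩
  rintro (_ | a) (_ | w₁) (_ | w₂) h₁ h₂ e₁ e₂
  all_goals
    simp only [Option.elim, addLeaf_adj_some_some, addLeaf_adj_none_left,
      addLeaf_adj_none_right, Option.some.injEq, reduceCtorEq] at h₁ h₂ e₁ e₂
  · subst h₁ h₂
    exact absurd (e₁.symm.trans e₂) (by simpa using by decide)
  · subst h₁
    exact absurd (e₁.symm.trans e₂) (by simpa using by decide)
  · subst h₁
    exact (hv _ h₂).2 e₂
  · subst h₂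
    exact (hv _ h₁).1 e₁
  · exact hlab _ _ _ h₁ h₂ e₁ e₂

/-- Every nonempty member of `K` has a vertex with no neighbor whose label exceeds its own
by `1` or `2`. -/
lemma inK.exists_free_vertex {V : Type} [Nonempty V] {G : SimpleGraph V} {ℓ : V → ZMod 5}
    (hG : inK G ℓ) : ∃ v, ∀ w, G.Adj v w → ℓ w ≠ ℓ v + 1 ∧ ℓ w ≠ ℓ v + 2 := by
  obtain ⟨hfin, hac, -⟩ := hG
  by_contra! h
  have h' : ∀ v, ∃ w, G.Adj v w ∧ (ℓ w = ℓ v + 1 ∨ ℓ w = ℓ v + 2) := fun v ↦ by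
    obtain ⟨w, hw, hl⟩ := h v
    exact ⟨w, hw, or_iff_not_imp_left.mpr hl⟩
  choose p hp hl using h'
  obtain ⟨v, hv⟩ := hac.exists_apply_apply_eq p hp
  have h₁ := hl v
  have h₂ := hl (p v)
  rw [hv] at h₂
  have key : ∀ a b : ZMod 5, (b = a + 1 ∨ b = a + 2) → ¬ (a = b + 1 ∨ a = b + 2) := by decide
  exact key _ _ h₁ h₂

/-- The class `K` fails CAP in a strong form: no nonempty `H ∈ K` has an extension
`H' ∈ K` witnessing cofinal amalgamation. -/
theorem stmt1 {V V' : Type} (H : SimpleGraph V) (ℓH : V → ZMod 5)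
    (H' : SimpleGraph V') (ℓH' : V' → ZMod 5)
    (hH : inK H ℓH) (hne : Nonempty V) (hH' : inK H' ℓH')
    (ι : H ↪g H') (hι : ∀ v, ℓH' (ι v) = ℓH v) :
    ∃ (VX VY : Type) (X : SimpleGraph VX) (ℓX : VX → ZMod 5)
      (Y : SimpleGraph VY) (ℓY : VY → ZMod 5) (f : H' ↪g X) (g : H' ↪g Y),
      inK X ℓX ∧ inK Y ℓY ∧ (∀ v, ℓX (f v) = ℓH' v) ∧ (∀ v, ℓY (g v) = ℓH' v) ∧
      ¬ ∃ (VW : Type) (W : SimpleGraph VW) (ℓW : VW → ZMod 5)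
          (f' : X ↪g W) (g' : Y ↪g W),
          inK W ℓW ∧ (∀ v, ℓW (f' v) = ℓX v) ∧ (∀ v, ℓW (g' v) = ℓY v) ∧
          ∀ v, f' (f v) = g' (g v) := by
  have : Nonempty V' := hne.map ι
  obtain ⟨v, hv⟩ := hH'.exists_free_vertex
  refine ⟨Option V', Option V', H'.addLeaf v, fun x ↦ x.elim (ℓH' v + 1) ℓH',
    H'.addLeaf v, fun x ↦ x.elim (ℓH' v + 2) ℓH', H'.addLeafEmbedding v, H'.addLeafEmbedding v,
    hH'.addLeaf hv _, hH'.addLeaf hv _, fun _ ↦ rfl, fun _ ↦ rfl, ?_⟩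
  rintro ⟨VW, W, ℓW, f', g', ⟨-, -, hW⟩, hf', hg', hcomm⟩
  have hℓ : ℓW (f' (some v)) = ℓH' v := hf' (some v)
  have hfg : f' (some v) = g' (some v) := hcomm v
  refine hW (f' (some v)) (f' none) (g' none) ?_ ?_ ?_ ?_
  · simp
  · simp [hfg]
  · rw [hℓ]; exact hf' none
  · rw [hℓ]; exact hg' none
end

section
/- The class P fails the cofinal amalgamation property in the following strong form: for every nonempty Z ∈ P and every Z' ∈ P containing Z as an induced substructure, there exist X, Y ∈ P and embeddings f : Z' → X and g : Z' → Y such that there is no W ∈ P with embeddings f' : X → W and g' : Y → W satisfying f' ∘ f = g' ∘ g. -/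
/-- The class `P`: finite structures `(A, S, T)` with two binary relations such that
`S ∪ T` is an (antisymmetric, irreflexive) directed forest, `S` and `T` are disjoint,
and all edges into a given vertex lie entirely in `S` or entirely in `T`. -/
def inP {A : Type} (S T : A → A → Prop) : Prop :=
  Finite A ∧
  (∀ v, ¬ S v v ∧ ¬ T v v) ∧
  (∀ v w, (S v w ∨ T v w) → ¬ (S w v ∨ T w v)) ∧
  (SimpleGraph.fromRel (fun v w => S v w ∨ T v w)).IsAcyclic ∧
  (∀ v w, ¬ (S v w ∧ T v w)) ∧
  (∀ w v v', S v w → T v' w → False)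

/-- An embedding between members of `P`. -/
def PEmb {A B : Type} (S T : A → A → Prop) (S' T' : B → B → Prop) (h : A → B) : Prop :=
  Function.Injective h ∧ (∀ x y, S x y ↔ S' (h x) (h y)) ∧ (∀ x y, T x y ↔ T' (h x) (h y))

/-- A forest stays a forest when a vertex with at most one neighbour is added. -/
theorem SimpleGraph.IsAcyclic.of_comap_some {V : Type*} {H : SimpleGraph (Option V)} {w : V}
    (hG : (H.comap some).IsAcyclic) (hw : ∀ x, H.Adj none x → x = some w) : H.IsAcyclic := by
  classical
  intro v c hc
  by_cases hnone : none ∈ c.support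
  · have hc' := hc.rotate hnone
    refine hc'.snd_ne_penultimate ?_
    rw [hw _ ((c.rotate none hnone).adj_snd hc'.not_nil),
      hw _ ((c.rotate none hnone).adj_penultimate hc'.not_nil).symm]
  · have hsupp : ∀ x ∈ c.support, x ∈ ({none}ᶜ : Set (Option V)) := by
      rintro x hx rfl
      exact hnone hx
    have hind : (H.induce {none}ᶜ).IsAcyclic := by
      refine hG.comap (G := H.induce {none}ᶜ)
        ⟨fun x => x.1.get (Option.isSome_iff_ne_none.2 x.2), ?_⟩ ?_
      · rintro ⟨a, ha⟩ ⟨b, hb⟩ hab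
        simpa using hab
      · rintro ⟨a, ha⟩ ⟨b, hb⟩ hab
        simpa [Option.get_inj] using hab
    refine hind (c.induce _ hsupp) ?_
    rw [← SimpleGraph.Walk.isCycle_map_iff_of_injective
      (f := (SimpleGraph.Embedding.induce (G := H) {none}ᶜ).toHom)
      (SimpleGraph.Embedding.induce (G := H) _).injective, SimpleGraph.Walk.map_induce]
    exact hc

/-- A finite nonempty oriented forest has a vertex without incoming edges. -/
theorem exists_source_of_isAcyclic {V : Type*} [Finite V] [Nonempty V] {R : V → V → Prop}
    (hR : ∀ v w, R v w → ¬ R w v) (hG : (SimpleGraph.fromRel R).IsAcyclic) :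
    ∃ w, ∀ v, ¬ R v w := by
  by_contra! h
  choose p hp using h
  obtain ⟨F, hGF, hF⟩ :=
    SimpleGraph.exists_maximal_isAcyclic_of_le_isAcyclic (G := ⊤) le_top hG
  have hcard := (SimpleGraph.isTree_iff_connected_and_card.1 <|
    SimpleGraph.connected_top.maximal_le_isAcyclic_iff_isTree le_top |>.1 hF).2
  have hne : ∀ v, p v ≠ v := fun v hv => by
    have := hp v
    rw [hv] at this
    exact hR _ _ this this
  let e : V → F.edgeSet := fun v => ⟨s(p v, v), hGF ⟨hne v, .inl (hp v)⟩⟩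
  have he : Function.Injective e := by
    intro v w hvw
    have h' : s(p v, v) = s(p w, w) := congrArg Subtype.val hvw
    rcases Sym2.eq_iff.1 h' with h' | ⟨h₁, h₂⟩
    · exact h'.2
    · have hv := hp v
      have hw := hp w
      rw [h₁] at hv
      rw [← h₂] at hw
      exact (hR _ _ hv hw).elim
  have := Nat.card_le_card_of_injective e he
  omega

/-- The relation on `Option V` extending `R` by the edge `none → some w` if `b` holds. -/
def pendantRel {V : Type} (R : V → V → Prop) (b : Prop) (w : V) : Option V → Option V → Prop
  | some x, some y => R x y
  | none, some y => b ∧ y = w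
  | _, none => False

/-- Adding to a member of `P` a new edge, in `S` or in `T`, from a new vertex to a vertex
without incoming edges yields a member of `P`. -/
theorem inP_pendantRel {V : Type} {S T : V → V → Prop} (h : inP S T) {w : V}
    (hw : ∀ v, ¬ (S v w ∨ T v w)) {a b : Prop} (hab : ¬ (a ∧ b)) :
    inP (pendantRel S a w) (pendantRel T b w) := by
  obtain ⟨hfin, hirr, hanti, hacyc, hdisj, hin⟩ := h
  refine ⟨inferInstance, ?_, ?_, ?_, ?_, ?_⟩
  · rintro (_ | v)
    · simp [pendantRel]
    · exact hirr v
  · rintro (_ | v) (_ | u)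
    · simp [pendantRel]
    · simp [pendantRel]
    · simp [pendantRel]
    · exact hanti v u
  · refine SimpleGraph.IsAcyclic.of_comap_some (w := w) ?_ ?_
    · convert hacyc using 1
      ext x y
      simp [pendantRel]
    · rintro (_ | x) hx
      · simp at hx
      · simp only [SimpleGraph.fromRel_adj, pendantRel] at hx
        grind
  · rintro (_ | v) (_ | u)
    · simp [pendantRel]
    · simp only [pendantRel]
      tauto
    · simp [pendantRel]
    · exact hdisj v u
  · rintro (_ | u) (_ | v) (_ | v') <;> simp only [pendantRel] <;> grind

theorem PEmb_some_pendantRel {V : Type} (S T : V → V → Prop) (a b : Prop) (w : V) :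
    PEmb S T (pendantRel S a w) (pendantRel T b w) some :=
  ⟨Option.some_injective V, fun _ _ => Iff.rfl, fun _ _ => Iff.rfl⟩

/-- The class `P` fails CAP in a strong form: no nonempty `Z ∈ P` has an extension
`Z' ∈ P` witnessing cofinal amalgamation. -/
theorem stmt4 {A A' : Type} (S T : A → A → Prop) (S' T' : A' → A' → Prop)
    (hZ : inP S T) (hne : Nonempty A) (hZ' : inP S' T')
    (ι : A → A') (hι : PEmb S T S' T' ι) :
    ∃ (B C : Type) (SX TX : B → B → Prop) (SY TY : C → C → Prop)
      (f : A' → B) (g : A' → C),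
      inP SX TX ∧ inP SY TY ∧ PEmb S' T' SX TX f ∧ PEmb S' T' SY TY g ∧
      ¬ ∃ (D : Type) (SW TW : D → D → Prop) (f' : B → D) (g' : C → D),
          inP SW TW ∧ PEmb SX TX SW TW f' ∧ PEmb SY TY SW TW g' ∧
          ∀ x, f' (f x) = g' (g x) := by
  obtain ⟨a⟩ := hne
  have : Nonempty A' := ⟨ι a⟩
  have : Finite A' := hZ'.1
  obtain ⟨w, hw⟩ := exists_source_of_isAcyclic hZ'.2.2.1 hZ'.2.2.2.1
  refine ⟨Option A', Option A', pendantRel S' True w, pendantRel T' False w,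
    pendantRel S' False w, pendantRel T' True w, some, some,
    inP_pendantRel hZ' hw (by simp), inP_pendantRel hZ' hw (by simp),
    PEmb_some_pendantRel .., PEmb_some_pendantRel .., ?_⟩
  rintro ⟨D, SW, TW, f', g', hW, hf, hg, hfg⟩
  have hS : SW (f' none) (f' (some w)) := (hf.2.1 _ _).1 ⟨trivial, rfl⟩
  have hT : TW (g' none) (g' (some w)) := (hg.2.2 _ _).1 ⟨trivial, rfl⟩
  rw [← hfg] at hT
  exact hW.2.2.2.2.2 _ _ _ hS hT
end

section
/- The class P has the weak amalgamation property: for every Z ∈ P there exists Y ∈ P containing Z as an induced substructure, such that for all X₁, X₂ ∈ P and all embeddings e₁ : Y → X₁ and e₂ : Y → X₂, there exist W ∈ P and embeddings e₁' : X₁ → W and e₂' : X₂ → W with e₁' ∘ e₁ and e₂' ∘ e₂ agreeing on Z. -/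
/-- Every edge `u → v` of `R` is separated by a two-colouring of the vertices for which
`u → v` is the only bichromatic edge. -/
def HasCuts {A : Type} (R : A → A → Prop) : Prop :=
  ∀ u v, R u v → ∃ c : A → Prop, ¬ (c u ↔ c v) ∧
    ∀ x y, R x y → ¬ (x = u ∧ y = v) → (c x ↔ c y)

/-- Every predicate invariant along the edges of `R` is constant. -/
def InvariantsConstant {A : Type} (R : A → A → Prop) : Prop :=
  ∀ p : A → Prop, (∀ x y, R x y → (p x ↔ p y)) → ∀ x y, p x ↔ p y

theorem HasCuts.irrefl {A : Type} {R : A → A → Prop} (h : HasCuts R) (v : A) : ¬ R v v :=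
  fun hv => (h v v hv).elim fun _ hc => hc.1 Iff.rfl

theorem HasCuts.asymm {A : Type} {R : A → A → Prop} (h : HasCuts R) {v w : A}
    (hvw : R v w) : ¬ R w v := by
  intro hwv
  obtain ⟨c, hc, hR⟩ := h v w hvw
  exact hc (hR w v hwv (by rintro ⟨rfl, -⟩; exact h.irrefl _ hvw)).symm

theorem SimpleGraph.Reachable.iff_of_invariant {V : Type} {G : SimpleGraph V} {c : V → Prop}
    (hc : ∀ x y, G.Adj x y → (c x ↔ c y)) {u v : V} (h : G.Reachable u v) : c u ↔ c v := by
  obtain ⟨w⟩ := h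
  induction w with
  | nil => rfl
  | cons hadj _ ih => exact (hc _ _ hadj).trans ih

theorem HasCuts.isAcyclic {A : Type} {R : A → A → Prop} (h : HasCuts R) :
    (SimpleGraph.fromRel R).IsAcyclic := by
  have key : ∀ u v, R u v →
      ¬ (SimpleGraph.fromRel R \ SimpleGraph.fromEdgeSet {s(u, v)}).Reachable u v := by
    intro u v huv hr
    obtain ⟨c, hc, hR⟩ := h u v huv
    refine hc (hr.iff_of_invariant ?_)
    intro x y hxy
    simp only [SimpleGraph.sdiff_adj, SimpleGraph.fromRel_adj, SimpleGraph.fromEdgeSet_adj,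
      Set.mem_singleton_iff, Sym2.eq_iff] at hxy
    obtain ⟨⟨hne, hxy | hyx⟩, hn⟩ := hxy
    · exact hR x y hxy fun e => hn ⟨Or.inl e, hne⟩
    · exact (hR y x hyx fun e => hn ⟨Or.inr e.symm, hne⟩).symm
  rw [SimpleGraph.isAcyclic_iff_forall_adj_isBridge]
  intro u v huv
  rw [SimpleGraph.isBridge_iff]
  rcases huv.2 with h' | h'
  · exact key u v h'
  · rw [Sym2.eq_swap]
    exact fun hr => key v u h' hr.symm

theorem hasCuts_of_isAcyclic {A : Type} {R : A → A → Prop} (hirr : ∀ v, ¬ R v v)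
    (hasymm : ∀ v w, R v w → ¬ R w v) (h : (SimpleGraph.fromRel R).IsAcyclic) :
    HasCuts R := by
  intro u v huv
  have hne : ∀ {x y}, R x y → x ≠ y := by
    rintro x _ hxy rfl
    exact hirr x hxy
  have hb := SimpleGraph.isAcyclic_iff_forall_adj_isBridge.mp h
    (show (SimpleGraph.fromRel R).Adj u v from ⟨hne huv, Or.inl huv⟩)
  rw [SimpleGraph.isBridge_iff] at hb
  refine ⟨fun x => (SimpleGraph.fromRel R \ SimpleGraph.fromEdgeSet {s(u, v)}).Reachable u x,
    fun e => hb (e.mp (SimpleGraph.Reachable.refl _)), ?_⟩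
  intro x y hxy hn
  have hadj : (SimpleGraph.fromRel R \ SimpleGraph.fromEdgeSet {s(u, v)}).Adj x y := by
    simp only [SimpleGraph.sdiff_adj, SimpleGraph.fromRel_adj, SimpleGraph.fromEdgeSet_adj,
      Set.mem_singleton_iff, Sym2.eq_iff]
    refine ⟨⟨hne hxy, Or.inl hxy⟩, ?_⟩
    rintro ⟨e | ⟨rfl, rfl⟩, -⟩
    · exact hn e
    · exact hasymm _ _ huv hxy
  exact ⟨fun hr => hr.trans hadj.reachable, fun hr => hr.trans hadj.symm.reachable⟩

theorem inP_iff {A : Type} {S T : A → A → Prop} :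
    inP S T ↔ Finite A ∧ HasCuts (fun v w => S v w ∨ T v w) ∧
      ∀ w v v', S v w → T v' w → False := by
  constructor
  · rintro ⟨hfin, hirr, hasymm, hac, -, htype⟩
    exact ⟨hfin, hasCuts_of_isAcyclic (fun v => not_or.mpr (hirr v)) hasymm hac, htype⟩
  · rintro ⟨hfin, hcuts, htype⟩
    exact ⟨hfin, fun v => not_or.mp (hcuts.irrefl v), fun _ _ h => hcuts.asymm h,
      hcuts.isAcyclic, fun v w h => htype w v v h.1 h.2, htype⟩

theorem PEmb.comp {A B C : Type} {S T : A → A → Prop} {S' T' : B → B → Prop}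
    {S'' T'' : C → C → Prop} {g : B → C} {f : A → B} (hg : PEmb S' T' S'' T'' g)
    (hf : PEmb S T S' T' f) : PEmb S T S'' T'' (g ∘ f) :=
  ⟨hg.1.comp hf.1, fun x y => (hf.2.1 x y).trans (hg.2.1 _ _),
    fun x y => (hf.2.2 x y).trans (hg.2.2 _ _)⟩

/-- Joining all components to one new vertex gives a connected extension in the class. -/
theorem exists_connected_extension {A : Type} {S T : A → A → Prop} (hZ : inP S T) :
    ∃ (K : Type) (S' T' : K → K → Prop) (ι : A → K), inP S' T' ∧ PEmb S T S' T' ι ∧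
      InvariantsConstant fun v w => S' v w ∨ T' v w := by
  obtain ⟨hfin, hcuts, htype⟩ := inP_iff.mp hZ
  let R : A → A → Prop := fun v w => S v w ∨ T v w
  let q : A → A := fun x => (Quot.mk R x).out
  have hmk : ∀ x, Quot.mk R (q x) = Quot.mk R x := fun x => Quot.out_eq _
  have hqR : ∀ {x y}, S x y ∨ T x y → q x = q y := fun {x y} h =>
    congrArg Quot.out (Quot.sound (r := R) h)
  have hqq : ∀ x, q (q x) = q x := fun x => congrArg Quot.out (hmk x)
  let S' : Option A → Option A → Prop
    | some x, some y => S x y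
    | some x, none => q x = x
    | none, _ => False
  let T' : Option A → Option A → Prop
    | some x, some y => T x y
    | _, _ => False
  refine ⟨Option A, S', T', some, inP_iff.mpr ⟨inferInstance, ?_, ?_⟩,
    ⟨Option.some_injective A, fun _ _ => Iff.rfl, fun _ _ => Iff.rfl⟩, ?_⟩
  · rintro (_ | u) (_ | v) huv
    · simp [S', T'] at huv
    · simp [S', T'] at huv
    · have hu : q u = u := by simpa [S', T'] using huv
      refine ⟨fun z => ∃ y, z = some y ∧ q y = u, by simp [hu], ?_⟩
      rintro (_ | x) (_ | y) hxy hn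
      · rfl
      · simp [S', T'] at hxy
      · have hx : q x = x := by simpa [S', T'] using hxy
        have : x ≠ u := by simpa using hn
        simp [hx, this]
      · simp [hqR hxy]
    · obtain ⟨c, hc, hR⟩ := hcuts u v huv
      refine ⟨fun z => z.elim (c (q u)) fun y => (q y = q u → c y) ∧ (q y ≠ q u → c (q u)),
        by simpa [hqR huv] using hc, ?_⟩
      rintro (_ | x) (_ | y) hxy hn
      · rfl
      · simp [S', T'] at hxy
      · have hx : q x = x := by simpa [S', T'] using hxy
        by_cases e : q x = q u
        · simp [← e, hx]
        · simp [e]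
      · have := hR x y hxy (by simpa using hn)
        simp [hqR hxy, this]
  · rintro (_ | w) (_ | v) (_ | v') h h'
    all_goals first | exact h | exact h' | exact htype _ _ _ h h'
  · intro p hp
    have hroot : ∀ z, p z ↔ p none := by
      rintro (_ | x)
      · rfl
      · let P : Quot R → Prop := Quot.lift (fun y => p (some y))
          fun y z h => propext (hp (some y) (some z) h)
        have h₁ : p (some (q x)) ↔ p (some x) := iff_of_eq (congrArg P (hmk x))
        exact h₁.symm.trans (hp (some (q x)) none (Or.inl (hqq x)))
    exact fun x y => (hroot x).trans (hroot y).symm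

/-- Attaching an in-neighbour to every vertex gives an extension in the class in which the type
of every old vertex is determined. -/
theorem exists_typed_extension {K : Type} {S T : K → K → Prop} (hK : inP S T) :
    ∃ (Y : Type) (S' T' : Y → Y → Prop) (ι : K → Y), inP S' T' ∧ PEmb S T S' T' ι ∧
      ∀ k, ∃ y, S' y (ι k) ∨ T' y (ι k) := by
  obtain ⟨hfin, hcuts, htype⟩ := inP_iff.mp hK
  let S' : K ⊕ K → K ⊕ K → Prop
    | .inl x, .inl y => S x y
    | .inr x, .inl y => x = y ∧ ¬ ∃ v, T v y
    | _, .inr _ => False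
  let T' : K ⊕ K → K ⊕ K → Prop
    | .inl x, .inl y => T x y
    | .inr x, .inl y => x = y ∧ ∃ v, T v y
    | _, .inr _ => False
  refine ⟨K ⊕ K, S', T', Sum.inl, inP_iff.mpr ⟨inferInstance, ?_, ?_⟩,
    ⟨Sum.inl_injective, fun _ _ => Iff.rfl, fun _ _ => Iff.rfl⟩, ?_⟩
  · have hpendant : ∀ {x y}, S' (.inr x) (.inl y) ∨ T' (.inr x) (.inl y) → x = y :=
      fun h => h.elim And.left And.left
    rintro (u | u) (v | v) huv
    · obtain ⟨c, hc, hR⟩ := hcuts u v huv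
      refine ⟨Sum.elim c c, hc, ?_⟩
      rintro (x | x) (y | y) hxy hn
      · exact hR x y hxy (by simpa using hn)
      · exact (or_self_iff.mp hxy).elim
      · rw [hpendant hxy]; rfl
      · exact (or_self_iff.mp hxy).elim
    · exact (or_self_iff.mp huv).elim
    · obtain rfl := hpendant huv
      refine ⟨fun z => z = .inr u, by simp, ?_⟩
      rintro (x | x) (y | y) hxy hn
      · simp
      · exact (or_self_iff.mp hxy).elim
      · obtain rfl := hpendant hxy
        have : x ≠ u := by simpa using hn
        simp [this]
      · exact (or_self_iff.mp hxy).elim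
    · exact (or_self_iff.mp huv).elim
  · rintro (w | w) (v | v) (v' | v') h h'
    · exact htype _ _ _ h h'
    · obtain ⟨t, ht⟩ := h'.2
      exact htype _ _ _ h ht
    · exact h.2 ⟨_, h'⟩
    · exact h.2 h'.2
    all_goals exact h
  · intro k
    refine ⟨.inr k, ?_⟩
    by_cases h : ∃ v, T v k
    · exact Or.inr ⟨rfl, h⟩
    · exact Or.inl ⟨rfl, h⟩

/-- Finite types amalgamate over injections, with the images meeting only in the common part. -/
theorem exists_finite_amalgam {K B C : Type} [Finite B] [Finite C] {f : K → B} {g : K → C}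
    (hf : Function.Injective f) (hg : Function.Injective g) :
    ∃ (D : Type) (i : B → D) (j : C → D), Finite D ∧ Function.Injective i ∧
      Function.Injective j ∧ (∀ k, i (f k) = j (g k)) ∧
      ∀ b c, i b = j c → ∃ k, b = f k ∧ c = g k := by
  classical
  let j : C → B ⊕ C := fun c => if h : ∃ k, g k = c then .inl (f h.choose) else .inr c
  have hj : ∀ k, j (g k) = .inl (f k) := by
    intro k
    have h : ∃ k', g k' = g k := ⟨k, rfl⟩
    simp only [j, dif_pos h]
    rw [hg h.choose_spec]
  have hj' : ∀ c, (¬ ∃ k, g k = c) → j c = .inr c := fun c h => dif_neg h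
  refine ⟨B ⊕ C, Sum.inl, j, inferInstance, Sum.inl_injective, ?_, fun k => (hj k).symm, ?_⟩
  · intro c c' h
    by_cases hc : ∃ k, g k = c <;> by_cases hc' : ∃ k, g k = c'
    · obtain ⟨k, rfl⟩ := hc
      obtain ⟨k', rfl⟩ := hc'
      rw [hj, hj] at h
      rw [hf (Sum.inl_injective h)]
    · obtain ⟨k, rfl⟩ := hc
      simp [hj, hj' c' hc'] at h
    · obtain ⟨k, rfl⟩ := hc'
      simp [hj, hj' c hc] at h
    · simpa [hj' c hc, hj' c' hc'] using h
  · intro b c h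
    by_cases hc : ∃ k, g k = c
    · obtain ⟨k, rfl⟩ := hc
      rw [hj] at h
      exact ⟨k, Sum.inl_injective h, rfl⟩
    · simp [hj' c hc] at h

/-- A cut of one factor at an edge extends over the free amalgam along a connected part. -/
theorem exists_cut_amalgam {K B C D : Type} {R : K → K → Prop} {RB : B → B → Prop}
    {RC : C → C → Prop} {f : K → B} {g : K → C} {i : B → D} {j : C → D}
    (hR : InvariantsConstant R) (hRB : ∀ k k', R k k' ↔ RB (f k) (f k'))
    (hRC : ∀ k k', R k k' ↔ RC (g k) (g k')) (hB : HasCuts RB) (hC : HasCuts RC)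
    (hi : Function.Injective i) (hj : Function.Injective j) (hij : ∀ k, i (f k) = j (g k))
    (hmeet : ∀ b c, i b = j c → ∃ k, b = f k ∧ c = g k) {u v : B} (huv : RB u v) :
    ∃ c : D → Prop, ¬ (c (i u) ↔ c (i v)) ∧
      (∀ x y, RB x y → ¬ (i x = i u ∧ i y = i v) → (c (i x) ↔ c (i y))) ∧
      (∀ x y, RC x y → ¬ (j x = i u ∧ j y = i v) → (c (j x) ↔ c (j y))) := by
  obtain ⟨c₁, hc₁, hmono₁⟩ := hB u v huv
  obtain ⟨c₂, hagree, hmono₂⟩ : ∃ c₂ : C → Prop, (∀ k, c₁ (f k) ↔ c₂ (g k)) ∧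
      ∀ x y, RC x y → ¬ (j x = i u ∧ j y = i v) → (c₂ x ↔ c₂ y) := by
    by_cases hK : ∃ k k', u = f k ∧ v = f k'
    · obtain ⟨k, k', rfl, rfl⟩ := hK
      obtain ⟨c, hc, hmono⟩ := hC (g k) (g k') ((hRC _ _).mp ((hRB _ _).mpr huv))
      have hmono' : ∀ x y, RC x y → ¬ (j x = i (f k) ∧ j y = i (f k')) → (c x ↔ c y) :=
        fun x y hxy hn => hmono x y hxy fun e => hn ⟨by rw [e.1, hij], by rw [e.2, hij]⟩
      -- The cut is oriented so that it agrees with `c₁` at the source of the edge.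
      refine ⟨fun x => c x ↔ (c₁ (f k) ↔ c (g k)), ?_,
        fun x y hxy hn => iff_congr (hmono' x y hxy hn) Iff.rfl⟩
      have hconst := hR (fun a => c₁ (f a) ↔ (c (g a) ↔ (c₁ (f k) ↔ c (g k)))) (by
        intro a b hab
        by_cases e : f a = f k ∧ f b = f k'
        · have hga : g a = g k := hj (by rw [← hij, ← hij, e.1])
          have hgb : g b = g k' := hj (by rw [← hij, ← hij, e.2])
          rw [e.1, e.2, hga, hgb]
          tauto
        · rw [hmono₁ _ _ ((hRB _ _).mp hab) e, hmono' _ _ ((hRC _ _).mp hab) fun e' =>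
            e ⟨hi ((hij a).trans e'.1), hi ((hij b).trans e'.2)⟩])
      exact fun a => (hconst k a).mp (by tauto)
    · refine ⟨fun _ => ∀ k, c₁ (f k), ?_, fun _ _ _ _ => Iff.rfl⟩
      have hconst := hR (fun k => c₁ (f k)) fun k k' h =>
        hmono₁ _ _ ((hRB _ _).mp h) fun e => hK ⟨k, k', e.1.symm, e.2.symm⟩
      exact fun k => ⟨fun h k' => (hconst k k').mp h, fun h => h k⟩
  have hci : ∀ b, ((∃ x, i b = i x ∧ c₁ x) ∨ ∃ y, i b = j y ∧ c₂ y) ↔ c₁ b := by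
    refine fun b => ⟨?_, fun h => Or.inl ⟨b, rfl, h⟩⟩
    rintro (⟨x, hx, h⟩ | ⟨y, hy, h⟩)
    · rwa [hi hx]
    · obtain ⟨k, rfl, rfl⟩ := hmeet _ _ hy
      exact (hagree k).mpr h
  have hcj : ∀ b, ((∃ x, j b = i x ∧ c₁ x) ∨ ∃ y, j b = j y ∧ c₂ y) ↔ c₂ b := by
    refine fun b => ⟨?_, fun h => Or.inr ⟨b, rfl, h⟩⟩
    rintro (⟨x, hx, h⟩ | ⟨y, hy, h⟩)
    · obtain ⟨k, rfl, rfl⟩ := hmeet _ _ hx.symm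
      exact (hagree k).mp h
    · rwa [hj hy]
  refine ⟨fun d => (∃ x, d = i x ∧ c₁ x) ∨ ∃ y, d = j y ∧ c₂ y, ?_, ?_, ?_⟩
  · simpa only [hci] using hc₁
  · intro x y hxy hn
    simp only [hci]
    exact hmono₁ x y hxy fun e => hn ⟨congrArg i e.1, congrArg i e.2⟩
  · intro x y hxy hn
    simp only [hcj]
    exact hmono₂ x y hxy hn

/-- The free amalgam of two relations `r`, `s` along maps `i`, `j`. -/
def glue {B C D : Type} (i : B → D) (j : C → D) (r : B → B → Prop) (s : C → C → Prop) :
    D → D → Prop :=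
  fun d d' => Relation.Map r i i d d' ∨ Relation.Map s j j d d'

theorem glue_left_iff {K B C D : Type} {R : K → K → Prop} {r : B → B → Prop} {s : C → C → Prop}
    {f : K → B} {g : K → C} {i : B → D} {j : C → D} (hr : ∀ k k', R k k' ↔ r (f k) (f k'))
    (hs : ∀ k k', R k k' ↔ s (g k) (g k')) (hi : Function.Injective i)
    (hmeet : ∀ b c, i b = j c → ∃ k, b = f k ∧ c = g k) (x y : B) :
    r x y ↔ glue i j r s (i x) (i y) := by
  refine ⟨fun h => Or.inl ⟨x, y, h, rfl, rfl⟩, ?_⟩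
  rintro (⟨a, b, h, ha, hb⟩ | ⟨a, b, h, ha, hb⟩)
  · rwa [← hi ha, ← hi hb]
  · obtain ⟨k, rfl, rfl⟩ := hmeet _ _ ha.symm
    obtain ⟨k', rfl, rfl⟩ := hmeet _ _ hb.symm
    exact (hr _ _).mp ((hs _ _).mpr h)

theorem glue_swap {B C D : Type} (i : B → D) (j : C → D) (r : B → B → Prop) (s : C → C → Prop)
    (d d' : D) : glue i j r s d d' ↔ glue j i s r d d' :=
  or_comm

/-- Free amalgamation over a connected common part whose vertices have matching types. -/
theorem exists_amalgam {K B C : Type} {S T : K → K → Prop} {SX TX : B → B → Prop}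
    {SY TY : C → C → Prop} {f : K → B} {g : K → C}
    (hconn : InvariantsConstant fun v w => S v w ∨ T v w) (hX : inP SX TX) (hY : inP SY TY)
    (hf : PEmb S T SX TX f) (hg : PEmb S T SY TY g)
    (hmatch : ∀ k, (∀ b c, SX b (f k) → TY c (g k) → False) ∧
      ∀ b c, TX b (f k) → SY c (g k) → False) :
    ∃ (D : Type) (SW TW : D → D → Prop) (i : B → D) (j : C → D),
      inP SW TW ∧ PEmb SX TX SW TW i ∧ PEmb SY TY SW TW j ∧ ∀ k, i (f k) = j (g k) := by
  obtain ⟨hfinB, hcutsX, htypeX⟩ := inP_iff.mp hX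
  obtain ⟨hfinC, hcutsY, htypeY⟩ := inP_iff.mp hY
  obtain ⟨hfi, hfS, hfT⟩ := hf
  obtain ⟨hgi, hgS, hgT⟩ := hg
  obtain ⟨D, i, j, hfin, hi, hj, hij, hmeet⟩ := exists_finite_amalgam hfi hgi
  have hmeet' : ∀ c b, j c = i b → ∃ k, c = g k ∧ b = f k := fun c b h =>
    (hmeet b c h.symm).imp fun _ => And.symm
  have hRX := fun k k' => or_congr (hfS k k') (hfT k k')
  have hRY := fun k k' => or_congr (hgS k k') (hgT k k')
  refine ⟨D, glue i j SX SY, glue i j TX TY, i, j, inP_iff.mpr ⟨hfin, ?_, ?_⟩,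
    ⟨hi, glue_left_iff hfS hgS hi hmeet, glue_left_iff hfT hgT hi hmeet⟩,
    ⟨hj, fun x y => ?_, fun x y => ?_⟩, hij⟩
  · have hglue : ∀ d d', glue i j SX SY d d' ∨ glue i j TX TY d d' →
        (∃ x y, (SX x y ∨ TX x y) ∧ i x = d ∧ i y = d') ∨
          ∃ x y, (SY x y ∨ TY x y) ∧ j x = d ∧ j y = d' := by
      rintro d d' ((⟨x, y, h, hd⟩ | ⟨x, y, h, hd⟩) | (⟨x, y, h, hd⟩ | ⟨x, y, h, hd⟩))
      · exact Or.inl ⟨x, y, Or.inl h, hd⟩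
      · exact Or.inr ⟨x, y, Or.inl h, hd⟩
      · exact Or.inl ⟨x, y, Or.inr h, hd⟩
      · exact Or.inr ⟨x, y, Or.inr h, hd⟩
    intro d d' hdd'
    rcases hglue d d' hdd' with ⟨u, v, huv, rfl, rfl⟩ | ⟨u, v, huv, rfl, rfl⟩
    · obtain ⟨c, hc, hcX, hcY⟩ := exists_cut_amalgam hconn hRX hRY hcutsX hcutsY hi hj hij
        hmeet huv
      refine ⟨c, hc, fun a b hab hn => ?_⟩
      rcases hglue a b hab with ⟨x, y, hxy, rfl, rfl⟩ | ⟨x, y, hxy, rfl, rfl⟩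
      · exact hcX x y hxy hn
      · exact hcY x y hxy hn
    · obtain ⟨c, hc, hcY, hcX⟩ := exists_cut_amalgam hconn hRY hRX hcutsY hcutsX hj hi
        (fun k => (hij k).symm) hmeet' huv
      refine ⟨c, hc, fun a b hab hn => ?_⟩
      rcases hglue a b hab with ⟨x, y, hxy, rfl, rfl⟩ | ⟨x, y, hxy, rfl, rfl⟩
      · exact hcX x y hxy hn
      · exact hcY x y hxy hn
  · rintro w v v' (⟨a, b, h, -, rfl⟩ | ⟨a, b, h, -, rfl⟩) (⟨a', b', h', -, e⟩ | ⟨a', b', h', -, e⟩)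
    · obtain rfl := hi e
      exact htypeX _ _ _ h h'
    · obtain ⟨k, rfl, rfl⟩ := hmeet _ _ e.symm
      exact (hmatch k).1 _ _ h h'
    · obtain ⟨k, rfl, rfl⟩ := hmeet _ _ e
      exact (hmatch k).2 _ _ h' h
    · obtain rfl := hj e
      exact htypeY _ _ _ h h'
  · rw [glue_swap]
    exact glue_left_iff hgS hfS hj hmeet' x y
  · rw [glue_swap]
    exact glue_left_iff hgT hfT hj hmeet' x y

/-- The class `P` has the weak amalgamation property. -/
theorem stmt5 {A : Type} (S T : A → A → Prop) (hZ : inP S T) :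
    ∃ (A' : Type) (S' T' : A' → A' → Prop) (ι : A → A'),
      inP S' T' ∧ PEmb S T S' T' ι ∧
      ∀ (B C : Type) (SX TX : B → B → Prop) (SY TY : C → C → Prop)
        (e₁ : A' → B) (e₂ : A' → C),
        inP SX TX → inP SY TY → PEmb S' T' SX TX e₁ → PEmb S' T' SY TY e₂ →
        ∃ (D : Type) (SW TW : D → D → Prop) (e₁' : B → D) (e₂' : C → D),
          inP SW TW ∧ PEmb SX TX SW TW e₁' ∧ PEmb SY TY SW TW e₂' ∧
          ∀ z : A, e₁' (e₁ (ι z)) = e₂' (e₂ (ι z)) := by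
  obtain ⟨K, SK, TK, ιK, hK, hιK, hconn⟩ := exists_connected_extension hZ
  obtain ⟨Y, S', T', ι, hY, hι, htyped⟩ := exists_typed_extension hK
  refine ⟨Y, S', T', ι ∘ ιK, hY, hι.comp hιK, ?_⟩
  intro B C SX TX SY TY e₁ e₂ hB hC he₁ he₂
  have htypeB := (inP_iff.mp hB).2.2
  have htypeC := (inP_iff.mp hC).2.2
  obtain ⟨D, SW, TW, i, j, hW, hi, hj, hij⟩ :=
    exists_amalgam hconn hB hC (he₁.comp hι) (he₂.comp hι) (by
      intro k
      obtain ⟨y, hy | hy⟩ := htyped k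
      · have h₁ := (he₁.2.1 _ _).mp hy
        have h₂ := (he₂.2.1 _ _).mp hy
        exact ⟨fun b c _ h => htypeC _ _ _ h₂ h, fun b c h _ => htypeB _ _ _ h₁ h⟩
      · have h₁ := (he₁.2.2 _ _).mp hy
        have h₂ := (he₂.2.2 _ _).mp hy
        exact ⟨fun b c h _ => htypeB _ _ _ h h₁, fun b c _ h => htypeC _ _ _ h h₂⟩)
  exact ⟨D, SW, TW, i, j, hW, hi, hj, fun z => hij (ιK z)⟩
end

section
/- The class 𝒢 fails the cofinal amalgamation property in the following strong form: for every H ∈ 𝒢 containing at least one edge and every H' ∈ 𝒢 containing H as an induced subgraph, there exist X, Y ∈ 𝒢 and graph embeddings f : H' → X and g : H' → Y such that there is no W ∈ 𝒢 with graph embeddings f' : X → W and g' : Y → W satisfying f' ∘ f = g' ∘ g. -/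
/-- The degree of a vertex (as the cardinality of its neighbor set). -/
noncomputable def deg {V : Type} (G : SimpleGraph V) (v : V) : ℕ :=
  {w | G.Adj v w}.ncard

/-- The class `𝒢`: finite acyclic simple graphs in which no two vertices of degree
greater than `2` are adjacent. -/
def inG {V : Type} (G : SimpleGraph V) : Prop :=
  Finite V ∧ G.IsAcyclic ∧ ∀ v w, G.Adj v w → 2 < deg G v → 2 < deg G w → False

/-- The graph obtained from `G` by attaching a new pendant vertex `none` at `v`. -/
def addLeaf {V : Type} (G : SimpleGraph V) (v : V) : SimpleGraph (Option V) where
  Adj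
    | some a, some b => G.Adj a b
    | none, some b => b = v
    | some a, none => a = v
    | none, none => False
  symm := ⟨by
    rintro (_ | a) (_ | b) h
    exacts [h, h, h, SimpleGraph.Adj.symm (G := G) h]⟩
  loopless := ⟨by
    rintro (_ | a) h
    exacts [h, G.irrefl h]⟩

section addLeaf

variable {V : Type} (G : SimpleGraph V) (v : V)

@[simp] lemma addLeaf_adj_some_some (a b : V) :
    (addLeaf G v).Adj (some a) (some b) ↔ G.Adj a b := Iff.rfl

@[simp] lemma addLeaf_adj_none_some (b : V) : (addLeaf G v).Adj none (some b) ↔ b = v := Iff.rfl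

@[simp] lemma addLeaf_adj_some_none (a : V) : (addLeaf G v).Adj (some a) none ↔ a = v := Iff.rfl

/-- The inclusion of `G` into the graph with a pendant vertex attached. -/
def addLeafEmbedding : G ↪g addLeaf G v where
  toFun := some
  inj' := Option.some_injective V
  map_rel_iff' := Iff.rfl

@[simp] lemma addLeafEmbedding_apply (a : V) : addLeafEmbedding G v a = some a := rfl

lemma eq_some_of_addLeaf_adj_none {a : Option V} (h : (addLeaf G v).Adj none a) : a = some v := by
  cases a with
  | none => exact absurd h (SimpleGraph.irrefl _)
  | some b => exact congrArg some h

lemma deg_addLeaf_none : deg (addLeaf G v) none = 1 := by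
  have : {w | (addLeaf G v).Adj none w} = {some v} := by
    ext a
    refine ⟨eq_some_of_addLeaf_adj_none G v, ?_⟩
    rintro rfl
    simp
  rw [deg, this, Set.ncard_singleton]

lemma deg_addLeaf_some_of_ne {w : V} (h : w ≠ v) : deg (addLeaf G v) (some w) = deg G w := by
  have : {x | (addLeaf G v).Adj (some w) x} = some '' {x | G.Adj w x} := by
    ext (_ | a) <;> simp [h]
  rw [deg, this, Set.ncard_image_of_injective _ (Option.some_injective V), deg]

lemma deg_addLeaf_some_self [Finite V] : deg (addLeaf G v) (some v) = deg G v + 1 := by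
  have : {x | (addLeaf G v).Adj (some v) x} = insert none (some '' {x | G.Adj v x}) := by
    ext (_ | a) <;> simp
  rw [deg, this, Set.ncard_insert_of_notMem (by simp),
    Set.ncard_image_of_injective _ (Option.some_injective V), deg]

lemma isAcyclic_addLeaf (hG : G.IsAcyclic) : (addLeaf G v).IsAcyclic := by
  rw [SimpleGraph.isAcyclic_iff_free_cycleGraph] at hG ⊢
  rintro n hn ⟨φ⟩
  obtain ⟨m, rfl⟩ : ∃ m, n = m + 3 := ⟨n - 3, by omega⟩
  by_cases hnone : ∃ i, φ i = none
  · obtain ⟨i, hi⟩ := hnone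
    have key (j) (hj : (SimpleGraph.cycleGraph (m + 3)).Adj i j) : φ j = some v := by
      refine eq_some_of_addLeaf_adj_none G v ?_
      rw [← hi]
      exact φ.toHom.map_adj hj
    have hsucc : φ (i + 1) = some v := key _ (by simp [SimpleGraph.cycleGraph_adj])
    have hpred : φ (i - 1) = some v := key _ (by simp [SimpleGraph.cycleGraph_adj])
    have h := φ.injective (hsucc.trans hpred.symm)
    have h2 : (1 + 1 : Fin (m + 3)) = 0 := by
      have := congrArg (fun x => x - i + 1) h
      simpa using this
    simp [Fin.ext_iff, Fin.val_add] at h2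
    rw [Nat.mod_eq_of_lt (by omega)] at h2
    omega
  · push Not at hnone
    choose ψ hψ using fun i => Option.ne_none_iff_exists'.mp (hnone i)
    refine hG (m + 3) hn ⟨⟨⟨ψ, fun {a b} hab => ?_⟩, fun a b hab => ?_⟩⟩
    · have := φ.toHom.map_adj hab
      simpa [hψ] using this
    · apply φ.injective
      have : ψ a = ψ b := hab
      simp [hψ, this]

variable {G v}

lemma inG_addLeaf (hG : inG G) (hv : deg G v ≤ 1 ∨ ∀ w, G.Adj v w → deg G w ≤ 2) :
    inG (addLeaf G v) := by
  obtain ⟨hfin, hacyc, hdeg⟩ := hG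
  refine ⟨inferInstance, isAcyclic_addLeaf G v hacyc, ?_⟩
  have hnone := deg_addLeaf_none G v
  have hself := deg_addLeaf_some_self G v
  rintro (_ | a) (_ | b) hab ha hb
  · omega
  · omega
  · omega
  · rw [addLeaf_adj_some_some] at hab
    by_cases hav : a = v
    · subst hav
      rw [deg_addLeaf_some_of_ne G a hab.ne'] at hb
      rcases hv with hv | hv
      · omega
      · have := hv b hab
        omega
    · rw [deg_addLeaf_some_of_ne G v hav] at ha
      by_cases hbv : b = v
      · subst hbv
        rcases hv with hv | hv
        · omega
        · have := hv a hab.symm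
          omega
      · rw [deg_addLeaf_some_of_ne G v hbv] at hb
        exact hdeg a b hab ha hb

end addLeaf

lemma exists_embedding_deg_eq_add {V : Type} (G : SimpleGraph V) (v : V) (hG : inG G)
    (hv : ∀ w, G.Adj v w → deg G w ≤ 2) (n : ℕ) :
    ∃ (U : Type) (X : SimpleGraph U) (f : G ↪g X), inG X ∧
      (∀ w, X.Adj (f v) w → deg X w ≤ 2) ∧ deg X (f v) = deg G v + n := by
  induction n with
  | zero => exact ⟨V, G, SimpleGraph.Embedding.refl, hG, hv, rfl⟩
  | succ n ih =>
    obtain ⟨U, X, f, hX, hnbr, hdeg⟩ := ih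
    have := hX.1
    refine ⟨Option U, addLeaf X (f v), (addLeafEmbedding X (f v)).comp f,
      inG_addLeaf hX (.inr hnbr), ?_, ?_⟩
    · rintro (_ | w) hw
      · rw [deg_addLeaf_none]
        omega
      · replace hw : X.Adj (f v) w := hw
        rw [deg_addLeaf_some_of_ne X (f v) hw.ne']
        exact hnbr w hw
    · change deg (addLeaf X (f v)) (some (f v)) = _
      rw [deg_addLeaf_some_self, hdeg, add_assoc]

lemma exists_embedding_two_lt_deg {V : Type} (G : SimpleGraph V) (v : V) (hG : inG G)
    (hv : ∀ w, G.Adj v w → deg G w ≤ 2) :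
    ∃ (U : Type) (X : SimpleGraph U) (f : G ↪g X), inG X ∧ 2 < deg X (f v) := by
  obtain ⟨U, X, f, hX, -, hdeg⟩ := exists_embedding_deg_eq_add G v hG hv 3
  exact ⟨U, X, f, hX, by omega⟩

/-- A vertex of degree at most one can be given a new neighbour of degree greater than two. -/
lemma exists_embedding_addLeaf_two_lt_deg {V : Type} (G : SimpleGraph V) (v : V) (hG : inG G)
    (hv : deg G v ≤ 1) :
    ∃ (U : Type) (X : SimpleGraph U) (f : addLeaf G v ↪g X), inG X ∧ 2 < deg X (f none) := by
  refine exists_embedding_two_lt_deg _ none (inG_addLeaf hG (.inl hv)) fun w hw => ?_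
  have := hG.1
  rw [eq_some_of_addLeaf_adj_none G v hw, deg_addLeaf_some_self]
  omega

lemma deg_le_of_embedding {V U : Type} [Finite U] {G : SimpleGraph V} {X : SimpleGraph U}
    (f : G ↪g X) (v : V) : deg G v ≤ deg X (f v) := by
  refine Set.ncard_le_ncard_of_injOn f (fun w hw => ?_) f.injective.injOn (Set.toFinite _)
  exact f.map_rel_iff.mpr hw

lemma exists_leaf {V : Type} [Finite V] {G : SimpleGraph V} (hG : G.IsAcyclic) {a b : V}
    (hab : G.Adj a b) : ∃ v w, G.Adj v w ∧ ∀ u, G.Adj v u → u = w := by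
  classical
  let c := G.connectedComponentMk a
  have htree := hG.isTree_connectedComponent c
  have hb : b ∈ c.supp := SimpleGraph.ConnectedComponent.sound hab.symm.reachable
  have : Fintype c := Fintype.ofFinite _
  have : Nontrivial c := ⟨⟨a, rfl⟩, ⟨b, hb⟩, fun h => hab.ne (congrArg Subtype.val h)⟩
  obtain ⟨v, hv⟩ := htree.exists_vert_degree_one_of_nontrivial
  obtain ⟨w, hw, huniq⟩ := SimpleGraph.degree_eq_one_iff_existsUnique_adj.mp hv
  refine ⟨v, w, hw, fun u hu => ?_⟩
  have hu' : u ∈ c.supp :=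
    (SimpleGraph.ConnectedComponent.sound hu.symm.reachable).trans v.2
  exact congrArg Subtype.val (huniq ⟨u, hu'⟩ hu)

lemma two_lt_deg_of_adj {V : Type} [Finite V] {G : SimpleGraph V} {v a b c : V}
    (ha : G.Adj v a) (hb : G.Adj v b) (hc : G.Adj v c) (hab : a ≠ b) (hac : a ≠ c) (hbc : b ≠ c) :
    2 < deg G v :=
  (Set.two_lt_ncard (Set.toFinite _)).mpr ⟨a, ha, b, hb, c, hc, hab, hac, hbc⟩

/-- The class `𝒢` fails CAP in a strong form: no non-discrete `H ∈ 𝒢` has an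
extension `H' ∈ 𝒢` witnessing cofinal amalgamation. -/
theorem stmt6 {V V' : Type} (H : SimpleGraph V) (H' : SimpleGraph V')
    (hH : inG H) (hedge : ∃ v w : V, H.Adj v w) (hH' : inG H')
    (ι : H ↪g H') :
    ∃ (VX VY : Type) (X : SimpleGraph VX) (Y : SimpleGraph VY)
      (f : H' ↪g X) (g : H' ↪g Y),
      inG X ∧ inG Y ∧
      ¬ ∃ (VW : Type) (W : SimpleGraph VW) (f' : X ↪g W) (g' : Y ↪g W),
          inG W ∧ ∀ v, f' (f v) = g' (g v) := by
  obtain ⟨a, b, hab⟩ := hedge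
  have := hH'.1
  obtain ⟨l, c, hlc, hleaf⟩ := exists_leaf hH'.2.1 (ι.map_rel_iff.mpr hab)
  have hl : deg H' l = 1 := by
    rw [deg, Set.ncard_eq_one]
    exact ⟨c, Set.ext fun u => ⟨hleaf u, fun h => h ▸ hlc⟩⟩
  obtain ⟨VX, X, f, hX, hfdeg⟩ := exists_embedding_addLeaf_two_lt_deg H' l hH' hl.le
  have hfl : X.Adj (f (some l)) (f none) := f.map_rel_iff.mpr rfl
  by_cases hc : deg H' c ≤ 2
  · obtain ⟨VY, Y, g, hY, hgdeg⟩ := exists_embedding_two_lt_deg H' l hH'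
      fun w hw => hleaf w hw ▸ hc
    refine ⟨VX, VY, X, Y, f.comp (addLeafEmbedding H' l), g, hX, hY, ?_⟩
    rintro ⟨VW, W, f', g', hW, hcomm⟩
    have := hW.1
    have hcl : f' (f (some l)) = g' (g l) := hcomm l
    refine hW.2.2 _ _ (f'.map_rel_iff.mpr hfl) ?_ (hfdeg.trans_le (deg_le_of_embedding f' _))
    rw [hcl]
    exact hgdeg.trans_le (deg_le_of_embedding g' _)
  · obtain ⟨VY, Y, g, hY, hgdeg⟩ := exists_embedding_addLeaf_two_lt_deg (addLeaf H' l) none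
      (inG_addLeaf hH' (.inl hl.le)) (deg_addLeaf_none H' l).le
    refine ⟨VX, VY, X, Y, f.comp (addLeafEmbedding H' l),
      (g.comp (addLeafEmbedding _ none)).comp (addLeafEmbedding H' l), hX, hY, ?_⟩
    rintro ⟨VW, W, f', g', hW, hcomm⟩
    have := hW.1
    have hcl : f' (f (some l)) = g' (g (some (some l))) := hcomm l
    have hcc : f' (f (some c)) = g' (g (some (some c))) := hcomm c
    let p : H' ↪g W := (f'.comp f).comp (addLeafEmbedding H' l)
    have hpc : W.Adj (p l) (p c) := p.map_rel_iff.mpr hlc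
    have hpx : W.Adj (p l) (f' (f none)) := f'.map_rel_iff.mpr hfl
    have hpy : W.Adj (p l) (g' (g (some none))) := by
      change W.Adj (f' (f (some l))) _
      rw [hcl]
      exact (g'.comp g).map_rel_iff.mpr rfl
    have hyz : W.Adj (g' (g (some none))) (g' (g none)) := (g'.comp g).map_rel_iff.mpr rfl
    have hcx : p c ≠ f' (f none) := fun h => by
      have := f.injective (f'.injective h)
      simp at this
    have hcy : p c ≠ g' (g (some none)) := fun h => by
      have := g.injective (g'.injective (hcc.symm.trans h))
      simp at this
    have hxy : f' (f none) = g' (g (some none)) := by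
      by_contra hne
      exact hW.2.2 _ _ hpc (two_lt_deg_of_adj hpc hpx hpy hcx hcy hne)
        ((not_le.mp hc).trans_le (deg_le_of_embedding p c))
    refine hW.2.2 _ _ hyz ?_ (hgdeg.trans_le (deg_le_of_embedding g' _))
    rw [← hxy]
    exact hfdeg.trans_le (deg_le_of_embedding f' _)
end

section
/- Every member of 𝒢 can be extended to a tame member of 𝒢: for every H ∈ 𝒢 there exists H' ∈ 𝒢 containing H as an induced subgraph such that H' is tame. -/
/-- A graph in `𝒢` is tame if it is connected with more than two vertices, every vertex
of degree `2` has a neighbor of degree `> 2`, and the unique neighbor of every vertex of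
degree `1` has degree `2`. -/
def tame {V : Type} (H : SimpleGraph V) : Prop :=
  H.Connected ∧ 2 < Nat.card V ∧
  (∀ v, deg H v = 2 → ∃ w, H.Adj v w ∧ 2 < deg H w) ∧
  (∀ v w, deg H v = 1 → H.Adj v w → deg H w = 2)

open SimpleGraph

/-- The graph obtained from `G` by adding, for each `w : W`, a new vertex whose only neighbor
is the vertex `p w` (or which is isolated, when `p w = none`). -/
def attachLeaves {V W : Type} (G : SimpleGraph V) (p : W → Option V) : SimpleGraph (V ⊕ W) where
  Adj
    | .inl a, .inl b => G.Adj a b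
    | .inl a, .inr w => p w = some a
    | .inr w, .inl a => p w = some a
    | .inr _, .inr _ => False
  symm := ⟨by
    rintro (a | a) (b | b) h
    · exact G.adj_symm h
    · exact h
    · exact h
    · exact h⟩
  loopless := ⟨by
    rintro (a | a) h
    · exact G.loopless.irrefl a h
    · exact h⟩

section attachLeaves

variable {V W : Type} (G : SimpleGraph V) (p : W → Option V)

@[simp] lemma attachLeaves_adj_inl_inl (a b : V) :
    (attachLeaves G p).Adj (.inl a) (.inl b) ↔ G.Adj a b := Iff.rfl

@[simp] lemma attachLeaves_adj_inl_inr (a : V) (w : W) :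
    (attachLeaves G p).Adj (.inl a) (.inr w) ↔ p w = some a := Iff.rfl

@[simp] lemma attachLeaves_adj_inr_inl (a : V) (w : W) :
    (attachLeaves G p).Adj (.inr w) (.inl a) ↔ p w = some a := Iff.rfl

@[simp] lemma attachLeaves_adj_inr_inr (v w : W) :
    ¬ (attachLeaves G p).Adj (.inr v) (.inr w) := id

/-- The original graph is an induced subgraph of the graph with leaves attached. -/
def attachLeavesEmbedding : G ↪g attachLeaves G p where
  toFun := .inl
  inj' := Sum.inl_injective
  map_rel_iff' := Iff.rfl

variable {G p}

lemma eq_of_attachLeaves_adj_inr {w : W} {x y : V ⊕ W}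
    (hx : (attachLeaves G p).Adj (.inr w) x) (hy : (attachLeaves G p).Adj (.inr w) y) : x = y := by
  rcases x with x | x <;> rcases y with y | y <;> simp_all

lemma isAcyclic_attachLeaves (hG : G.IsAcyclic) : (attachLeaves G p).IsAcyclic := by
  classical
  intro u c hc
  have hsupp : ∀ x ∈ c.support, x ∈ Set.range (Sum.inl : V → V ⊕ W) := by
    rintro (x | x) hx
    · exact ⟨x, rfl⟩
    · have hc' := hc.rotate hx
      exact (hc'.snd_ne_penultimate (eq_of_attachLeaves_adj_inr
        (Walk.adj_snd hc'.not_nil) (Walk.adj_penultimate hc'.not_nil).symm)).elim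
  let f : (attachLeaves G p).induce (Set.range (Sum.inl : V → V ⊕ W)) →g G :=
    { toFun := fun x => x.2.choose
      map_rel' := by
        intro x y h
        have hx := x.2.choose_spec
        have hy := y.2.choose_spec
        have h' : (attachLeaves G p).Adj x.1 y.1 := h
        rw [← hx, ← hy] at h'
        exact h' }
  have hf : Function.Injective f := by
    intro x y h
    have h' : x.2.choose = y.2.choose := h
    exact Subtype.ext (x.2.choose_spec.symm.trans ((congrArg Sum.inl h').trans y.2.choose_spec))
  refine hG.comap f hf (c.induce _ hsupp) ?_
  let e := Embedding.induce (G := attachLeaves G p) (Set.range Sum.inl)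
  refine (Walk.isCycle_map_iff_of_injective (f := e.toHom) e.injective).1 ?_
  rwa [Walk.map_induce]

lemma connected_attachLeaves (hG : G.Connected) (hp : ∀ w, p w ≠ none) :
    (attachLeaves G p).Connected := by
  obtain ⟨v⟩ := hG.nonempty
  have hl : ∀ a, (attachLeaves G p).Reachable (.inl a) (.inl v) := fun a =>
    (hG.preconnected a v).map (attachLeavesEmbedding G p).toHom
  have key : ∀ x, (attachLeaves G p).Reachable x (.inl v) := by
    rintro (a | w)
    · exact hl a
    · obtain ⟨a, ha⟩ := Option.ne_none_iff_exists'.1 (hp w)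
      exact (Adj.reachable (show (attachLeaves G p).Adj (.inr w) (.inl a) from ha)).trans (hl a)
  exact { preconnected := fun x y => (key x).trans (key y).symm, nonempty := ⟨.inl v⟩ }

lemma deg_attachLeaves_inl [Finite V] [Finite W] (v : V) :
    deg (attachLeaves G p) (.inl v) = deg G v + {w | p w = some v}.ncard := by
  have h : {x | (attachLeaves G p).Adj (.inl v) x} =
      Sum.inl '' {w | G.Adj v w} ∪ Sum.inr '' {w | p w = some v} := by
    ext (x | x) <;> simp
  rw [deg, h, Set.ncard_union_eq _ (Set.toFinite _) (Set.toFinite _),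
    Set.ncard_image_of_injective _ Sum.inl_injective,
    Set.ncard_image_of_injective _ Sum.inr_injective, deg]
  rw [Set.disjoint_left]
  rintro _ ⟨a, -, rfl⟩ ⟨b, -, h⟩
  cases h

lemma deg_attachLeaves_inr {w : W} {v : V} (h : p w = some v) :
    deg (attachLeaves G p) (.inr w) = 1 := by
  rw [deg, Set.ncard_eq_one]
  refine ⟨.inl v, ?_⟩
  ext (x | x) <;> simp [h, eq_comm]

end attachLeaves

lemma deg_le_of_subset {V : Type} {G : SimpleGraph V} {v : V} {t : Set V} (ht : t.Finite)
    (h : ∀ w, G.Adj v w → w ∈ t) : deg G v ≤ t.ncard :=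
  Set.ncard_le_ncard h ht

/-- `S` is an independent dominating set of the finite forest `G`, and every vertex outside `S`
has degree at most two. -/
structure IsSkeleton {V : Type} (G : SimpleGraph V) (S : Set V) : Prop where
  finite : Finite V
  isAcyclic : G.IsAcyclic
  indep : ∀ v ∈ S, ∀ w ∈ S, ¬ G.Adj v w
  dominating : ∀ v ∉ S, ∃ w ∈ S, G.Adj v w
  deg_le_two : ∀ v ∉ S, deg G v ≤ 2

lemma inG.exists_isSkeleton {V : Type} {G : SimpleGraph V} (hG : inG G) :
    ∃ S, IsSkeleton G S := by
  obtain ⟨hfin, hac, hbig⟩ := hG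
  obtain ⟨S, hS, hmax⟩ :=
    (Set.toFinite {S : Set V | ∀ v ∈ S, ∀ w ∈ S, ¬ G.Adj v w}).exists_le_maximal (show {v | 2 < deg G v} ∈ _ from fun v hv w hw h => hbig v w h hv hw)
  refine ⟨S, hfin, hac, hmax.prop, fun v hv => ?_, fun v hv => not_lt.1 fun h => hv (hS h)⟩
  by_contra! hno
  refine hv (hmax.le_of_ge (y := insert v S) ?_ (Set.subset_insert v S) (Set.mem_insert v S))
  rintro a (rfl | ha) b (rfl | hb) hab
  · exact G.irrefl hab
  · exact hno b hb hab
  · exact hno a ha hab.symm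
  · exact hmax.prop a ha b hb hab

/-- Joining all components to a new hub through subdivided edges makes the graph connected. -/
lemma IsSkeleton.exists_connected {V : Type} {G : SimpleGraph V} {S : Set V}
    (h : IsSkeleton G S) :
    ∃ (V' : Type) (G' : SimpleGraph V') (_ : G ↪g G') (S' : Set V'),
      IsSkeleton G' S' ∧ G'.Connected ∧ S'.Nonempty := by
  have := h.finite
  let F₀ : SimpleGraph (V ⊕ Unit) := attachLeaves G fun _ => none
  let F : SimpleGraph ((V ⊕ Unit) ⊕ S) := attachLeaves F₀ fun _ => some (.inr ())
  let E : SimpleGraph ((V ⊕ Unit) ⊕ S) := attachLeaves F₀ fun s => some (.inl s)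
  have hF : F.IsAcyclic := isAcyclic_attachLeaves (isAcyclic_attachLeaves h.isAcyclic)
  have hub : ∀ x, (F ⊔ E).Reachable x (.inl (.inr ())) := by
    have hm : ∀ s : S, (F ⊔ E).Reachable (.inr s) (.inl (.inr ())) := fun s =>
      Adj.reachable (Or.inl rfl)
    have hs : ∀ s : S, (F ⊔ E).Reachable (.inl (.inl s)) (.inl (.inr ())) := fun s =>
      (Adj.reachable (Or.inr rfl)).trans (hm s)
    rintro ((v | _) | s)
    · by_cases hv : v ∈ S
      · exact hs ⟨v, hv⟩
      · obtain ⟨w, hw, hvw⟩ := h.dominating v hv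
        exact (Adj.reachable (Or.inl hvw)).trans (hs ⟨w, hw⟩)
    · exact .rfl
    · exact hm s
  have hconn : (F ⊔ E).Connected :=
    { preconnected := fun x y => (hub x).trans (hub y).symm, nonempty := ⟨.inl (.inr ())⟩ }
  obtain ⟨T, hFT, hTE, hT⟩ := hconn.exists_isTree_le_of_le_of_isAcyclic le_sup_left hF
  have hVV : ∀ a b : V, T.Adj (.inl (.inl a)) (.inl (.inl b)) ↔ G.Adj a b := fun a b =>
    ⟨fun hab => (hTE hab).elim id id, fun hab => hFT hab⟩
  let S' : Set ((V ⊕ Unit) ⊕ S) :=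
    {x | x = .inl (.inr ()) ∨ ∃ s ∈ S, x = .inl (.inl s)}
  have hmem : ∀ v, Sum.inl (Sum.inl v) ∈ S' ↔ v ∈ S := fun v => by simp [S']
  refine ⟨_, T, ⟨⟨fun v => .inl (.inl v), fun a b hab => by simpa using hab⟩, hVV _ _⟩, S',
    ⟨inferInstance, hT.isAcyclic, ?_, ?_, ?_⟩, hT.connected, ⟨_, Or.inl rfl⟩⟩
  · rintro _ (rfl | ⟨s, hs, rfl⟩) _ (rfl | ⟨t, ht, rfl⟩) hst
    · exact T.irrefl hst
    · rcases hTE hst with h' | h' <;> simp [F, E, F₀] at h'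
    · rcases hTE hst with h' | h' <;> simp [F, E, F₀] at h'
    · exact h.indep s hs t ht ((hVV _ _).1 hst)
  · rintro ((v | _) | s) hv
    · rw [hmem] at hv
      obtain ⟨w, hw, hvw⟩ := h.dominating v hv
      exact ⟨.inl (.inl w), (hmem w).2 hw, (hVV _ _).2 hvw⟩
    · exact (hv (Or.inl rfl)).elim
    · exact ⟨_, Or.inl rfl, hFT rfl⟩
  · rintro ((v | _) | s) hv
    · rw [hmem] at hv
      refine (deg_le_of_subset (t := (fun w => .inl (.inl w)) '' {w | G.Adj v w})
        (Set.toFinite _) ?_).trans ((Set.ncard_image_le (Set.toFinite _)).trans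
          (h.deg_le_two v hv))
      rintro ((w | _) | s) hw
      · exact ⟨w, (hVV _ _).1 hw, rfl⟩
      · rcases hTE hw with h' | h' <;> simp [F, E, F₀] at h'
      · rcases hTE hw with h' | h' <;> simp [F, E, F₀] at h'
        exact (hv (h' ▸ s.2)).elim
    · exact (hv (Or.inl rfl)).elim
    · refine (deg_le_of_subset (t := {.inl (.inr ()), .inl (.inl s)})
        (Set.toFinite _) ?_).trans ((Set.ncard_insert_le _ _).trans
          (by rw [Set.ncard_singleton]))
      rintro ((w | _) | t) hw
      · rcases hTE hw with h' | h' <;> simp [F, E, F₀] at h'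
        simp [h']
      · simp
      · rcases hTE hw with h' | h' <;> simp [F, E] at h'

/-- Attaching three leaves to every vertex of the skeleton makes all their degrees large. -/
lemma IsSkeleton.exists_two_lt_deg {V : Type} {G : SimpleGraph V} {S : Set V}
    (h : IsSkeleton G S) (hG : G.Connected) (hS : S.Nonempty) :
    ∃ (V' : Type) (G' : SimpleGraph V') (_ : G ↪g G') (S' : Set V'),
      IsSkeleton G' S' ∧ G'.Connected ∧ S'.Nonempty ∧ ∀ s ∈ S', 2 < deg G' s := by
  have := h.finite
  let p : S × Fin 3 → Option V := fun x => some x.1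
  refine ⟨_, attachLeaves G p, attachLeavesEmbedding G p, Sum.inl '' S,
    ⟨inferInstance, isAcyclic_attachLeaves h.isAcyclic, ?_, ?_, ?_⟩,
    connected_attachLeaves hG (by simp [p]), hS.image _, ?_⟩
  · rintro _ ⟨s, hs, rfl⟩ _ ⟨t, ht, rfl⟩
    exact h.indep s hs t ht
  · rintro (v | w) hv
    · obtain ⟨w, hw, hvw⟩ := h.dominating v fun hv' => hv ⟨v, hv', rfl⟩
      exact ⟨.inl w, ⟨w, hw, rfl⟩, hvw⟩
    · exact ⟨.inl w.1, ⟨w.1, w.1.2, rfl⟩, rfl⟩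
  · rintro (v | w) hv
    · have hv' : v ∉ S := fun hv' => hv ⟨v, hv', rfl⟩
      have h0 : {w | p w = some v} = ∅ := by
        ext w
        simp only [p, Set.mem_ofPred_eq, Option.some.injEq, Set.mem_empty_iff_false, iff_false]
        rintro rfl
        exact hv' w.1.2
      rw [deg_attachLeaves_inl, h0, Set.ncard_empty]
      exact h.deg_le_two v hv'
    · have hw : p w = some w.1.1 := rfl
      rw [deg_attachLeaves_inr hw]
      norm_num
  · rintro _ ⟨s, hs, rfl⟩
    have h3 : 3 ≤ {w | p w = some s}.ncard := by
      have hinj : Function.Injective fun i : Fin 3 => ((⟨s, hs⟩, i) : S × Fin 3) :=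
        Prod.mk_right_injective _
      have := Set.ncard_le_ncard (s := Set.range fun i : Fin 3 => ((⟨s, hs⟩, i) : S × Fin 3))
        (t := {w | p w = some s}) (by rintro _ ⟨i, rfl⟩; rfl) (Set.toFinite _)
      rwa [← Set.image_univ, Set.ncard_image_of_injective _ hinj, Set.ncard_univ,
        Nat.card_eq_fintype_card, Fintype.card_fin] at this
    rw [deg_attachLeaves_inl]
    omega

/-- Attaching a leaf to every vertex of degree one produces a tame graph. -/
lemma IsSkeleton.exists_tame {V : Type} {G : SimpleGraph V} {S : Set V}
    (h : IsSkeleton G S) (hG : G.Connected) (hS : S.Nonempty) (hdeg : ∀ s ∈ S, 2 < deg G s) :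
    ∃ (V' : Type) (G' : SimpleGraph V') (_ : G ↪g G'), inG G' ∧ tame G' := by
  have := h.finite
  let p : {v // deg G v = 1} → Option V := fun x => some x
  have hone : ∀ v, deg G v = 1 → {w | p w = some v}.ncard = 1 := fun v hv => by
    rw [Set.ncard_eq_one]
    refine ⟨⟨v, hv⟩, ?_⟩
    ext w
    simp [p, Subtype.ext_iff]
  have hzero : ∀ v, deg G v ≠ 1 → {w | p w = some v}.ncard = 0 := fun v hv => by
    rw [Set.ncard_eq_zero, Set.eq_empty_iff_forall_notMem]
    rintro w hw
    have : w.1 = v := Option.some.inj hw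
    exact hv (this ▸ w.2)
  have hin : ∀ s ∈ S, 2 < deg (attachLeaves G p) (.inl s) := fun s hs => by
    rw [deg_attachLeaves_inl]
    exact (hdeg s hs).trans_le (Nat.le_add_right _ _)
  have hout : ∀ v ∉ S, deg (attachLeaves G p) (.inl v) = 2 := fun v hv => by
    obtain ⟨w, -, hvw⟩ := h.dominating v hv
    have hpos : 0 < deg G v := (Set.ncard_pos (Set.toFinite _)).2 ⟨w, hvw⟩
    have hle := h.deg_le_two v hv
    rw [deg_attachLeaves_inl]
    by_cases h1 : deg G v = 1
    · rw [hone v h1, h1]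
    · rw [hzero v h1]
      omega
  have hleaf : ∀ w, deg (attachLeaves G p) (.inr w) = 1 := fun w =>
    deg_attachLeaves_inr (v := w.1) rfl
  refine ⟨_, attachLeaves G p, attachLeavesEmbedding G p,
    ⟨inferInstance, isAcyclic_attachLeaves h.isAcyclic, ?_⟩,
    connected_attachLeaves hG (by simp [p]), ?_, ?_, ?_⟩
  · have hbig : ∀ x, 2 < deg (attachLeaves G p) x → ∃ s ∈ S, x = .inl s := by
      rintro (v | w) hx
      · refine ⟨v, ?_, rfl⟩
        by_contra hv
        have := hout v hv
        omega
      · have := hleaf w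
        omega
    intro x y hxy hx hy
    obtain ⟨s, hs, rfl⟩ := hbig x hx
    obtain ⟨t, ht, rfl⟩ := hbig y hy
    exact h.indep s hs t ht hxy
  · obtain ⟨s, hs⟩ := hS
    exact (hin s hs).trans_le (Set.ncard_le_card _)
  · rintro (v | w) hv
    · have hv' : v ∉ S := fun hs => by
        have := hin v hs
        omega
      obtain ⟨w, hw, hvw⟩ := h.dominating v hv'
      exact ⟨.inl w, hvw, hin w hw⟩
    · have := hleaf w
      omega
  · rintro (v | w) (x | y) hv hvx
    · by_cases hs : v ∈ S
      · have := hin v hs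
        omega
      · have := hout v hs
        omega
    · by_cases hs : v ∈ S
      · have := hin v hs
        omega
      · have := hout v hs
        omega
    · have hwx : w.1 = x := Option.some.inj hvx
      refine hout x fun hx => ?_
      have h1 := hdeg x hx
      have h2 := w.2
      rw [hwx] at h2
      omega
    · exact hvx.elim

/-- Every member of `𝒢` extends to a tame member of `𝒢`. -/
theorem stmt8 {V : Type} (H : SimpleGraph V) (hH : inG H) :
    ∃ (V' : Type) (H' : SimpleGraph V') (_ : H ↪g H'), inG H' ∧ tame H' := by
  obtain ⟨S, hS⟩ := hH.exists_isSkeleton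
  obtain ⟨V₁, G₁, f₁, S₁, h₁, hc₁, hn₁⟩ := hS.exists_connected
  obtain ⟨V₂, G₂, f₂, S₂, h₂, hc₂, hn₂, hd₂⟩ := h₁.exists_two_lt_deg hc₁ hn₁
  obtain ⟨V₃, G₃, f₃, h₃⟩ := h₂.exists_tame hc₂ hn₂ hd₂
  exact ⟨V₃, G₃, (f₁.trans f₂).trans f₃, h₃⟩
end

section
/- Each non-discrete graph in 𝒢_A contains either a free cycle or a vertex of degree one; that is, if G ∈ 𝒢_A has at least one edge, then either G has a cycle containing at most one vertex of degree greater than 2, or G has a vertex of degree exactly 1. -/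
/-- The class `𝒢_A`: finite simple graphs in which every cycle has length in `A`,
no two distinct cycles share an edge, and every cycle contains at most two vertices of
degree greater than `2`. -/
def inGA (A : Set ℕ) {V : Type} (G : SimpleGraph V) : Prop :=
  Finite V ∧
  (∀ (v : V) (c : G.Walk v v), c.IsCycle → c.length ∈ A) ∧
  (∀ (v v' : V) (c : G.Walk v v) (c' : G.Walk v' v'), c.IsCycle → c'.IsCycle →
    (∃ e, e ∈ c.edges ∧ e ∈ c'.edges) → ∀ e, e ∈ c.edges ↔ e ∈ c'.edges) ∧
  (∀ (v : V) (c : G.Walk v v), c.IsCycle → {u | u ∈ c.support ∧ 2 < deg G u}.ncard ≤ 2)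

/-- `b` can be reached from `a` by a walk avoiding the vertex `x`. -/
def ReachAvoiding {V : Type} (G : SimpleGraph V) (x a b : V) : Prop :=
  ∃ p : G.Walk a b, x ∉ p.support

namespace ReachAvoiding

variable {V : Type} {G : SimpleGraph V} {x a b c : V}

theorem refl (h : x ≠ a) : ReachAvoiding G x a a :=
  ⟨SimpleGraph.Walk.nil, by simpa using h⟩

theorem symm (h : ReachAvoiding G x a b) : ReachAvoiding G x b a := by
  obtain ⟨p, hp⟩ := h
  exact ⟨p.reverse, by simpa using hp⟩

theorem trans (h : ReachAvoiding G x a b) (h' : ReachAvoiding G x b c) :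
    ReachAvoiding G x a c := by
  obtain ⟨p, hp⟩ := h
  obtain ⟨q, hq⟩ := h'
  exact ⟨p.append q, by simp [SimpleGraph.Walk.mem_support_append_iff, hp, hq]⟩

theorem ne_left (h : ReachAvoiding G x a b) : x ≠ a := by
  obtain ⟨p, hp⟩ := h
  rintro rfl
  exact hp p.start_mem_support

theorem ne_right (h : ReachAvoiding G x a b) : x ≠ b :=
  h.symm.ne_left

theorem of_adj (h : G.Adj a b) (ha : x ≠ a) (hb : x ≠ b) : ReachAvoiding G x a b :=
  ⟨h.toWalk, by simp [ha, hb]⟩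

theorem exists_isPath (h : ReachAvoiding G x a b) :
    ∃ p : G.Walk a b, p.IsPath ∧ x ∉ p.support := by
  classical
  obtain ⟨p, hp⟩ := h
  exact ⟨p.bypass, p.bypass_isPath, fun hx => hp (p.support_bypass_subset_support hx)⟩

end ReachAvoiding

section

variable {V : Type} {G : SimpleGraph V}

/-- A path between two distinct neighbours of `y` that avoids `y` closes up to a cycle. -/
theorem isCycle_cons_concat {y a b : V} (ha : G.Adj y a) (hb : G.Adj b y) (hab : a ≠ b)
    {p : G.Walk a b} (hp : p.IsPath) (hy : y ∉ p.support) :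
    (SimpleGraph.Walk.cons ha (p.concat hb)).IsCycle := by
  rw [SimpleGraph.Walk.cons_isCycle_iff]
  refine ⟨hp.concat hy hb, ?_⟩
  rw [SimpleGraph.Walk.edges_concat, List.concat_eq_append, List.mem_append, not_or]
  refine ⟨fun h => hy (p.fst_mem_support_of_mem_edges h), ?_⟩
  have := ha.ne
  simp only [List.mem_singleton, Sym2.eq_iff]
  grind

theorem mem_edges_cons_concat_iff {y a b c : V} (ha : G.Adj y a) (hb : G.Adj b y)
    {p : G.Walk a b} (hy : y ∉ p.support) :
    s(y, c) ∈ (SimpleGraph.Walk.cons ha (p.concat hb)).edges ↔ c = a ∨ c = b := by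
  have h : s(y, c) ∉ p.edges := fun h => hy (p.fst_mem_support_of_mem_edges h)
  have := ha.ne
  have := hb.ne
  simp only [SimpleGraph.Walk.edges_cons, SimpleGraph.Walk.edges_concat,
    List.concat_eq_append, List.mem_cons, List.mem_append, Sym2.eq_iff, h]
  grind

/-- If intersecting cycles have the same edges, a vertex whose neighbours stay mutually
connected after deleting it has degree at most two. -/
theorem deg_le_two_of_reachAvoiding [Finite V]
    (hG : ∀ (v v' : V) (c : G.Walk v v) (c' : G.Walk v' v'), c.IsCycle → c'.IsCycle →
      (∃ e, e ∈ c.edges ∧ e ∈ c'.edges) → ∀ e, e ∈ c.edges ↔ e ∈ c'.edges)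
    {y : V} (h : ∀ a b, G.Adj y a → G.Adj y b → ReachAvoiding G y a b) :
    deg G y ≤ 2 := by
  by_contra! hdeg
  obtain ⟨a, b, c, ha, hb, hc, hab, hac, hbc⟩ :=
    (Set.two_lt_ncard_iff (Set.toFinite _)).1 hdeg
  rw [Set.mem_ofPred_eq] at ha hb hc
  obtain ⟨p, hp, hyp⟩ := (h a b ha hb).exists_isPath
  obtain ⟨q, hq, hyq⟩ := (h a c ha hc).exists_isPath
  have key := hG y y _ _ (isCycle_cons_concat ha hb.symm hab hp hyp)
    (isCycle_cons_concat ha hc.symm hac hq hyq)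
    ⟨s(y, a), by simp, by simp⟩ s(y, b)
  rw [mem_edges_cons_concat_iff ha _ hyp, mem_edges_cons_concat_iff ha _ hyq] at key
  grind

/-- Some edge `x s` of a finite graph with an edge is such that no vertex on the `s`-side of
`x` separates any of its neighbours from `x`. -/
theorem exists_adj_forall_reachAvoiding [Finite V] (hedge : ∃ v w : V, G.Adj v w) :
    ∃ x s, G.Adj x s ∧ ∀ y z, ReachAvoiding G x s y → G.Adj y z → ReachAvoiding G y z x := by
  classical
  obtain ⟨v, w, hvw⟩ := hedge
  obtain ⟨⟨x, s⟩, hxs, hmin⟩ := Set.exists_min_image {e : V × V | G.Adj e.1 e.2}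
    (fun e => {b | ReachAvoiding G e.1 e.2 b}.ncard) (Set.toFinite _) ⟨(v, w), hvw⟩
  refine ⟨x, s, hxs, fun y z hy hyz => ?_⟩
  by_contra hz
  have hzx : x ≠ z := by
    rintro rfl
    exact hz (.refl hy.ne_right.symm)
  refine (hmin (y, z) hyz).not_gt (Set.ncard_lt_ncard ⟨?_, fun hsub => ?_⟩)
  · rintro b ⟨p, hp⟩
    refine (hy.trans (.of_adj hyz hy.ne_right hzx)).trans ⟨p, fun hx => hz ?_⟩
    exact ⟨p.takeUntil x hx, fun h => hp (p.support_takeUntil_subset_support hx h)⟩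
  · exact (hsub hy).ne_right rfl

end

/-- Every non-discrete graph in `𝒢_A` contains a free cycle (a cycle with at most one
vertex of degree `> 2`) or a vertex of degree one. -/
theorem stmt9 (A : Set ℕ) (hA : A ⊆ {n | 3 ≤ n}) (hA2 : A.Nontrivial)
    {V : Type} (G : SimpleGraph V) (hG : inGA A G)
    (hedge : ∃ v w : V, G.Adj v w) :
    (∃ (v : V) (c : G.Walk v v), c.IsCycle ∧ {u | u ∈ c.support ∧ 2 < deg G u}.ncard ≤ 1) ∨
    (∃ v : V, deg G v = 1) := by
  classical
  obtain ⟨hfin, -, hcyc, -⟩ := hG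
  obtain ⟨x, s, hxs, hreach⟩ := exists_adj_forall_reachAvoiding hedge
  refine or_iff_not_imp_right.2 fun hone => ?_
  have hs : ReachAvoiding G x s s := .refl hxs.ne
  obtain ⟨t, hst, htx⟩ : ∃ t, G.Adj s t ∧ t ≠ x := by
    by_contra! h
    refine hone ⟨s, Set.ncard_eq_one.2 ⟨x, ?_⟩⟩
    ext t
    exact ⟨h t, fun ht => ht ▸ hxs.symm⟩
  obtain ⟨p, hp, hsp⟩ := (hreach s t hs hst).exists_isPath
  refine ⟨s, _, isCycle_cons_concat hst hxs htx hp hsp, ?_⟩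
  refine (Set.ncard_le_ncard (t := {x}) ?_).trans (Set.ncard_singleton x).le
  rintro u ⟨hu, hdeg⟩
  by_contra hux
  rw [Set.mem_singleton_iff] at hux
  have hside : ReachAvoiding G x s u := by
    have hu' : u = s ∨ u ∈ p.support := by
      simp only [SimpleGraph.Walk.support_cons, SimpleGraph.Walk.support_concat,
        List.mem_cons, List.mem_append] at hu
      grind
    obtain rfl | hu' := hu'
    · exact hs
    · exact (ReachAvoiding.of_adj hst hxs.ne htx.symm).trans
        ⟨p.takeUntil u hu', SimpleGraph.Walk.endpoint_notMem_support_takeUntil hp hu' (Ne.symm hux)⟩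
  exact hdeg.not_ge (deg_le_two_of_reachAvoiding hcyc fun a b ha hb =>
    (hreach u a hside ha).trans (hreach u b hside hb).symm)
end

section
/- Suppose G ∈ 𝒢_A contains an edge e with endpoints v and w which is not contained in any cycle of G, and let n ∈ A. Then the graph H obtained from G by adjoining n − 2 new vertices forming a new path of length n − 1 from v to w (internally disjoint from G) belongs to 𝒢_A. -/
namespace SimpleGraph

/-- A vertex of a cycle that is incident to an edge outside the cycle has degree at least three. -/
theorem Walk.IsCycle.two_lt_deg {V : Type} [Finite V] {G : SimpleGraph V} {u a b : V}
    {c : G.Walk u u} (hc : c.IsCycle) (ha : a ∈ c.support) (hab : G.Adj a b)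
    (hnot : s(a, b) ∉ c.edges) : 2 < deg G a := by
  rw [← hc.ncard_neighborSet_toSubgraph_eq_two ha]
  refine Set.ncard_lt_ncard ⟨fun x hx => hx.adj_sub, fun h => hnot ?_⟩ (Set.toFinite _)
  exact Walk.adj_toSubgraph_iff_mem_edges.1 (h hab)

/-- A cycle passing through a vertex of degree at most two uses every edge at that vertex. -/
theorem Walk.IsCycle.mem_edges_of_neighbors_subset_pair {V : Type} {G : SimpleGraph V}
    {u a b x y : V} {c : G.Walk u u} (hc : c.IsCycle) (ha : a ∈ c.support) (hab : G.Adj a b)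
    (hsub : ∀ z, G.Adj a z → z = x ∨ z = y) : s(a, b) ∈ c.edges := by
  have h2 := hc.ncard_neighborSet_toSubgraph_eq_two ha
  have hss : c.toSubgraph.neighborSet a ⊆ {x, y} := fun z hz => hsub z hz.adj_sub
  have heq := Set.eq_of_subset_of_ncard_le hss
    (by rw [h2]; exact (Set.ncard_insert_le x {y}).trans (by simp))
  rw [← Walk.adj_toSubgraph_iff_mem_edges, ← Subgraph.mem_neighborSet, heq]
  exact hsub b hab

/-- A cycle uses no more than two edges at a vertex. -/
theorem Walk.IsCycle.eq_or_eq_of_mem_edges {V : Type} {G : SimpleGraph V}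
    {u a x y z : V} {c : G.Walk u u} (hc : c.IsCycle) (hx : s(a, x) ∈ c.edges)
    (hy : s(a, y) ∈ c.edges) (hxy : x ≠ y) (hz : s(a, z) ∈ c.edges) : z = x ∨ z = y := by
  have h2 := hc.ncard_neighborSet_toSubgraph_eq_two (c.fst_mem_support_of_mem_edges hx)
  have hss : ({x, y} : Set V) ⊆ c.toSubgraph.neighborSet a := by
    rintro t (rfl | rfl)
    · exact Walk.adj_toSubgraph_iff_mem_edges.2 hx
    · exact Walk.adj_toSubgraph_iff_mem_edges.2 hy
  have heq := Set.eq_of_subset_of_ncard_le hss (by rw [h2, Set.ncard_pair hxy])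
    (Set.finite_of_ncard_ne_zero (by omega))
  have : z ∈ c.toSubgraph.neighborSet a := Walk.adj_toSubgraph_iff_mem_edges.2 hz
  rwa [← heq] at this

/-- A set of vertices that meets a walk and is closed under the edges of the walk contains the
support of the walk. -/
theorem Walk.support_subset_of_closed {V : Type} {G : SimpleGraph V} {u w a : V}
    (c : G.Walk u w) {T : Set V} (ha : a ∈ c.support) (haT : a ∈ T)
    (hT : ∀ x y, s(x, y) ∈ c.edges → x ∈ T → y ∈ T) : ∀ b ∈ c.support, b ∈ T := by
  induction c generalizing a with
  | nil => simp_all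
  | cons h p ih =>
    have hT' : ∀ x y, s(x, y) ∈ p.edges → x ∈ T → y ∈ T :=
      fun x y hxy => hT x y (by simp [hxy])
    have key : ∀ b ∈ p.support, b ∈ T := by
      rcases List.mem_cons.1 (by simpa using ha) with rfl | ha'
      · exact ih p.start_mem_support (hT _ _ (by simp) haT) hT'
      · exact ih ha' haT hT'
    intro b hb
    rcases List.mem_cons.1 (by simpa using hb) with rfl | hmem
    · exact hT _ _ (by simp [Sym2.eq_swap]) (key _ p.start_mem_support)
    · exact key b hmem

/-- A walk whose support lies in the range of an embedding lifts along that embedding. -/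
theorem Walk.exists_map_eq_of_support_subset_range {V W : Type} {G : SimpleGraph V}
    {H : SimpleGraph W} (f : G ↪g H) {x y : W} (p : H.Walk x y)
    (hp : ∀ z ∈ p.support, z ∈ Set.range f) {a b : V} (hx : f a = x) (hy : f b = y) :
    ∃ q : G.Walk a b, (q.map f.toHom).copy hx hy = p := by
  induction p generalizing a with
  | nil =>
    obtain rfl : a = b := f.injective (hx.trans hy.symm)
    subst hx
    exact ⟨Walk.nil, rfl⟩
  | cons h p ih =>
    obtain ⟨d, hd⟩ := hp _ (List.mem_cons_of_mem _ p.start_mem_support)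
    subst hx hd
    obtain ⟨q, hq⟩ := ih (fun z hz => hp z (List.mem_cons_of_mem _ hz)) rfl hy
    subst hy
    exact ⟨Walk.cons (f.map_adj_iff.1 h) q, by simpa using hq⟩

/-- `H` arises from `G` by adjoining `n - 2` new vertices that form a path of length `n - 1`
from `v` to `w`. -/
structure IsEarExtension {V : Type} (G : SimpleGraph V) (v w : V) (n : ℕ)
    (H : SimpleGraph (V ⊕ Fin (n - 2))) : Prop where
  three_le : 3 ≤ n
  adj_inl_inl : ∀ a b : V, H.Adj (Sum.inl a) (Sum.inl b) ↔ G.Adj a b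
  adj_inl_inr : ∀ (a : V) (i : Fin (n - 2)), H.Adj (Sum.inl a) (Sum.inr i) ↔
    ((a = v ∧ i.val = 0) ∨ (a = w ∧ i.val = n - 3))
  adj_inr_inr : ∀ i j : Fin (n - 2), H.Adj (Sum.inr i) (Sum.inr j) ↔
    (i.val + 1 = j.val ∨ j.val + 1 = i.val)

namespace IsEarExtension

variable {V : Type} {G : SimpleGraph V} {v w : V} {n : ℕ} {H : SimpleGraph (V ⊕ Fin (n - 2))}

/-- The inclusion of the original graph into an ear extension. -/
def inlEmbedding (h : IsEarExtension G v w n H) : G ↪g H where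
  toFun := Sum.inl
  inj' := Sum.inl_injective
  map_rel_iff' := h.adj_inl_inl _ _

/-- A cycle of an ear extension that avoids the new vertices comes from the original graph. -/
theorem exists_isCycle_lift (h : IsEarExtension G v w n H) {x : V ⊕ Fin (n - 2)}
    {c : H.Walk x x} (hc : c.IsCycle) (hno : ∀ i, Sum.inr i ∉ c.support) :
    ∃ (a : V) (d : G.Walk a a), d.IsCycle ∧ c.length = d.length ∧
      c.support = d.support.map Sum.inl ∧ c.edges = d.edges.map (Sym2.map Sum.inl) := by
  have hrange : ∀ z ∈ c.support, z ∈ Set.range h.inlEmbedding := by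
    rintro (a | i) hz
    · exact ⟨a, rfl⟩
    · exact absurd hz (hno i)
  obtain ⟨a, rfl⟩ := hrange x c.start_mem_support
  obtain ⟨d, rfl⟩ := c.exists_map_eq_of_support_subset_range h.inlEmbedding hrange rfl rfl
  rw [Walk.copy_rfl_rfl] at *
  refine ⟨a, d, (Walk.isCycle_map_iff_of_injective h.inlEmbedding.injective).1 hc,
    Walk.length_map _ _, Walk.support_map _ _, Walk.edges_map _ _⟩

/-- A new vertex has at most two neighbors. -/
theorem exists_neighbors_subset_pair (h : IsEarExtension G v w n H) (i : Fin (n - 2)) :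
    ∃ x y, ∀ z, H.Adj (Sum.inr i) z → z = x ∨ z = y := by
  have hlt := i.isLt
  refine ⟨if i.val = 0 then Sum.inl v else Sum.inr ⟨i.val - 1, by omega⟩,
    if hl : i.val = n - 3 then Sum.inl w else Sum.inr ⟨i.val + 1, by omega⟩, ?_⟩
  rintro (a | j) hadj
  · rcases (h.adj_inl_inr a i).1 hadj.symm with ⟨rfl, h0⟩ | ⟨rfl, h0⟩
    · left; simp [h0]
    · right; simp [h0]
  · have hj := j.isLt
    rcases (h.adj_inr_inr i j).1 hadj with h0 | h0
    · right
      rw [dif_neg (by omega)]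
      exact congrArg Sum.inr (Fin.ext h0.symm)
    · left
      rw [if_neg (by omega)]
      exact congrArg Sum.inr (Fin.ext (by simp; omega))

/-- A cycle through a new vertex uses every edge at that vertex. -/
theorem mem_edges_of_inr_mem_support (h : IsEarExtension G v w n H) {x : V ⊕ Fin (n - 2)}
    {c : H.Walk x x} (hc : c.IsCycle) {i : Fin (n - 2)} (hi : Sum.inr i ∈ c.support)
    {z : V ⊕ Fin (n - 2)} (hz : H.Adj (Sum.inr i) z) : s(Sum.inr i, z) ∈ c.edges := by
  obtain ⟨a, b, hab⟩ := h.exists_neighbors_subset_pair i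
  exact hc.mem_edges_of_neighbors_subset_pair hi hz hab

/-- A cycle through one new vertex passes through all of them. -/
theorem inr_mem_support (h : IsEarExtension G v w n H) {x : V ⊕ Fin (n - 2)}
    {c : H.Walk x x} (hc : c.IsCycle) {i : Fin (n - 2)} (hi : Sum.inr i ∈ c.support)
    (j : Fin (n - 2)) : Sum.inr j ∈ c.support := by
  have step : ∀ i j : Fin (n - 2), Sum.inr i ∈ c.support →
      (i.val + 1 = j.val ∨ j.val + 1 = i.val) → Sum.inr j ∈ c.support := fun i j hi hij =>
    c.snd_mem_support_of_mem_edges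
      (h.mem_edges_of_inr_mem_support hc hi ((h.adj_inr_inr i j).2 hij))
  have down : ∀ k (hk : k < n - 2), Sum.inr ⟨k, hk⟩ ∈ c.support →
      Sum.inr ⟨0, by omega⟩ ∈ c.support := by
    intro k
    induction k with
    | zero => exact fun _ hk => hk
    | succ k ih => exact fun hk hs => ih (by omega) (step _ _ hs (Or.inr rfl))
  have up : ∀ k (hk : k < n - 2), Sum.inr ⟨k, hk⟩ ∈ c.support := by
    intro k
    induction k with
    | zero => exact fun _ => down i.val i.isLt hi
    | succ k ih => exact fun hk => step _ _ (ih (by omega)) (Or.inl rfl)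
  exact up j.val j.isLt

/-- If `s(v, w)` is a bridge of `G`, a cycle through a new vertex uses the edge `s(v, w)`. -/
theorem inl_inl_mem_edges (h : IsEarExtension G v w n H) (hbr : G.IsBridge s(v, w))
    {x : V ⊕ Fin (n - 2)} {c : H.Walk x x} (hc : c.IsCycle) {i : Fin (n - 2)}
    (hi : Sum.inr i ∈ c.support) : s(Sum.inl v, Sum.inl w) ∈ c.edges := by
  by_contra hnot
  have h3 := h.three_le
  set z : Fin (n - 2) := ⟨0, by omega⟩
  have hfirst : s(Sum.inl v, Sum.inr z) ∈ c.edges := by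
    rw [Sym2.eq_swap]
    exact h.mem_edges_of_inr_mem_support hc (h.inr_mem_support hc hi z)
      ((h.adj_inl_inr v z).2 (Or.inl ⟨rfl, rfl⟩)).symm
  have htransfer : ∀ e ∈ c.edges, e ∈ (H.deleteEdges {s(Sum.inl v, Sum.inl w)}).edgeSet := by
    intro e he
    rw [edgeSet_deleteEdges]
    exact ⟨c.edges_subset_edgeSet he, fun heq => hnot (heq ▸ he)⟩
  obtain ⟨-, hreach⟩ := adj_and_reachable_delete_edges_iff_exists_cycle.2
    ⟨x, c.transfer _ htransfer, hc.transfer htransfer, by rwa [Walk.edges_transfer]⟩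
  have hinv : ∀ a b : V ⊕ Fin (n - 2),
      ((H.deleteEdges {s(Sum.inl v, Sum.inl w)}).deleteEdges {s(Sum.inl v, Sum.inr z)}).Adj a b →
      Sum.elim (fun a => (G.deleteEdges {s(v, w)}).Reachable a w) (fun _ => True) b →
      Sum.elim (fun a => (G.deleteEdges {s(v, w)}).Reachable a w) (fun _ => True) a := by
    rintro (a | i) (b | j) hadj hb
    · simp only [deleteEdges_adj, h.adj_inl_inl, Set.mem_singleton_iff] at hadj
      refine Reachable.trans (Adj.reachable ?_) hb
      rw [deleteEdges_adj]
      refine ⟨hadj.1.1, fun heq => hadj.1.2 ?_⟩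
      exact congrArg (Sym2.map Sum.inl) (Set.mem_singleton_iff.1 heq)
    · simp only [deleteEdges_adj, h.adj_inl_inr, Set.mem_singleton_iff] at hadj
      obtain ⟨⟨⟨rfl, h0⟩ | ⟨rfl, -⟩, -⟩, hne⟩ := hadj
      · exact absurd (by rw [show j = z from Fin.ext h0]) hne
      · exact Reachable.refl _
    · trivial
    · trivial
  have hall : ∀ a b : V ⊕ Fin (n - 2),
      ((H.deleteEdges {s(Sum.inl v, Sum.inl w)}).deleteEdges
        {s(Sum.inl v, Sum.inr z)}).Walk a b →
      Sum.elim (fun a => (G.deleteEdges {s(v, w)}).Reachable a w) (fun _ => True) b →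
      Sum.elim (fun a => (G.deleteEdges {s(v, w)}).Reachable a w) (fun _ => True) a := by
    intro a b p
    induction p with
    | nil => exact id
    | cons hadj _ ih => exact fun hb => hinv _ _ hadj (ih hb)
  obtain ⟨p⟩ := hreach
  exact isBridge_iff.1 hbr (hall _ _ p trivial)

/-- If `s(v, w)` is a bridge of `G`, a cycle through a new vertex consists of `v`, `w` and the
new vertices. -/
theorem mem_support_iff (h : IsEarExtension G v w n H) (hbr : G.IsBridge s(v, w))
    {x : V ⊕ Fin (n - 2)} {c : H.Walk x x} (hc : c.IsCycle) {i : Fin (n - 2)}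
    (hi : Sum.inr i ∈ c.support) (y : V ⊕ Fin (n - 2)) :
    y ∈ c.support ↔ y = Sum.inl v ∨ y = Sum.inl w ∨ ∃ j, y = Sum.inr j := by
  have h3 := h.three_le
  have hvw := h.inl_inl_mem_edges hbr hc hi
  have hv : s(Sum.inl v, Sum.inr ⟨0, by omega⟩) ∈ c.edges := by
    rw [Sym2.eq_swap]
    exact h.mem_edges_of_inr_mem_support hc (h.inr_mem_support hc hi _)
      ((h.adj_inl_inr v _).2 (Or.inl ⟨rfl, rfl⟩)).symm
  have hw : s(Sum.inl w, Sum.inr ⟨n - 3, by omega⟩) ∈ c.edges := by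
    rw [Sym2.eq_swap]
    exact h.mem_edges_of_inr_mem_support hc (h.inr_mem_support hc hi _)
      ((h.adj_inl_inr w _).2 (Or.inr ⟨rfl, rfl⟩)).symm
  constructor
  · refine c.support_subset_of_closed
      (T := {y | y = Sum.inl v ∨ y = Sum.inl w ∨ ∃ j, y = Sum.inr j}) hi (by simp) ?_ y
    rintro a b hab (rfl | rfl | ⟨j, rfl⟩)
    · rcases hc.eq_or_eq_of_mem_edges hvw hv (by simp) hab with rfl | rfl <;> simp
    · rcases hc.eq_or_eq_of_mem_edges (Sym2.eq_swap ▸ hvw) hw (by simp) hab with rfl | rfl <;>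
        simp
    · rcases b with b | k
      · rcases (h.adj_inl_inr b j).1 (c.adj_of_mem_edges hab).symm with ⟨rfl, -⟩ | ⟨rfl, -⟩ <;>
          simp
      · simp
  · rintro (rfl | rfl | ⟨j, rfl⟩)
    · exact c.fst_mem_support_of_mem_edges hvw
    · exact c.snd_mem_support_of_mem_edges hvw
    · exact h.inr_mem_support hc hi j

/-- If `s(v, w)` is a bridge of `G`, the edges of a cycle through a new vertex are `s(v, w)` and
the edges incident to new vertices. -/
theorem mem_edges_iff (h : IsEarExtension G v w n H) (hbr : G.IsBridge s(v, w))
    {x : V ⊕ Fin (n - 2)} {c : H.Walk x x} (hc : c.IsCycle) {i : Fin (n - 2)}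
    (hi : Sum.inr i ∈ c.support) (e : Sym2 (V ⊕ Fin (n - 2))) :
    e ∈ c.edges ↔
      e = s(Sum.inl v, Sum.inl w) ∨ (e ∈ H.edgeSet ∧ ∃ j : Fin (n - 2), Sum.inr j ∈ e) := by
  constructor
  · intro he
    have heH := c.edges_subset_edgeSet he
    induction e with
    | _ a b =>
      have ha := (h.mem_support_iff hbr hc hi a).1 (c.fst_mem_support_of_mem_edges he)
      have hb := (h.mem_support_iff hbr hc hi b).1 (c.snd_mem_support_of_mem_edges he)
      have hne : a ≠ b := H.ne_of_adj heH
      rcases ha with rfl | rfl | ⟨j, rfl⟩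
      · rcases hb with rfl | rfl | ⟨k, rfl⟩
        · exact absurd rfl hne
        · exact Or.inl rfl
        · exact Or.inr ⟨heH, k, by simp⟩
      · rcases hb with rfl | rfl | ⟨k, rfl⟩
        · exact Or.inl Sym2.eq_swap
        · exact absurd rfl hne
        · exact Or.inr ⟨heH, k, by simp⟩
      · exact Or.inr ⟨heH, j, by simp⟩
  · rintro (rfl | ⟨heH, j, hj⟩)
    · exact h.inl_inl_mem_edges hbr hc hi
    · obtain ⟨b, rfl⟩ := hj
      exact h.mem_edges_of_inr_mem_support hc (h.inr_mem_support hc hi j) heH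

/-- If `s(v, w)` is a bridge of `G`, a cycle through a new vertex shares no edge with a cycle that
avoids the new vertices. -/
theorem notMem_edges_of_mem_edges (h : IsEarExtension G v w n H) (hbr : G.IsBridge s(v, w))
    (hnc : ∀ (u : V) (c : G.Walk u u), c.IsCycle → s(v, w) ∉ c.edges)
    {x x' : V ⊕ Fin (n - 2)} {c : H.Walk x x} (hc : c.IsCycle) {i : Fin (n - 2)}
    (hi : Sum.inr i ∈ c.support) {c' : H.Walk x' x'} (hc' : c'.IsCycle)
    (hno : ∀ i, Sum.inr i ∉ c'.support) {e : Sym2 (V ⊕ Fin (n - 2))} (he : e ∈ c.edges) :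
    e ∉ c'.edges := by
  intro he'
  rcases (h.mem_edges_iff hbr hc hi e).1 he with rfl | ⟨-, j, hj⟩
  · obtain ⟨a, d, hd, -, -, hde⟩ := h.exists_isCycle_lift hc' hno
    rw [hde, List.mem_map] at he'
    obtain ⟨f, hf, hfe⟩ := he'
    obtain rfl := Sym2.map.injective Sum.inl_injective (a₂ := s(v, w)) hfe
    exact hnc a d hd hf
  · exact hno j (c'.mem_support_of_mem_edges he' hj)

/-- If `s(v, w)` is a bridge of `G`, a cycle through a new vertex has length `n`. -/
theorem length_eq (h : IsEarExtension G v w n H) (hvw : v ≠ w) (hbr : G.IsBridge s(v, w))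
    {x : V ⊕ Fin (n - 2)} {c : H.Walk x x} (hc : c.IsCycle) {i : Fin (n - 2)}
    (hi : Sum.inr i ∈ c.support) : c.length = n := by
  classical
  have h3 := h.three_le
  have hset : c.support.tail.toFinset = ({v, w} : Finset V).disjSum Finset.univ := by
    ext y
    have htail : y ∈ c.support.tail ↔ y ∈ c.support := by
      rw [Walk.mem_support_iff, or_iff_right_of_imp]
      rintro rfl
      exact Walk.end_mem_tail_support hc.not_nil
    rw [List.mem_toFinset, htail, h.mem_support_iff hbr hc hi]
    rcases y with y | y <;> simp
  have hcard := congrArg Finset.card hset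
  rw [List.toFinset_card_of_nodup hc.support_nodup, Finset.card_disjSum,
    Finset.card_pair hvw, Finset.card_univ, Fintype.card_fin, List.length_tail,
    Walk.length_support] at hcard
  omega

/-- A new vertex has degree at most two. -/
theorem deg_inr_le (h : IsEarExtension G v w n H) (i : Fin (n - 2)) :
    deg H (Sum.inr i) ≤ 2 := by
  obtain ⟨a, b, hab⟩ := h.exists_neighbors_subset_pair i
  exact (Set.ncard_le_ncard (t := {a, b}) hab).trans
    ((Set.ncard_insert_le _ _).trans (by simp))

/-- Vertices other than `v` and `w` keep their degree. -/
theorem deg_inl (h : IsEarExtension G v w n H) {a : V} (hv : a ≠ v) (hw : a ≠ w) :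
    deg H (Sum.inl a) = deg G a := by
  have : {y | H.Adj (Sum.inl a) y} = Sum.inl '' {b | G.Adj a b} := by
    ext (b | i)
    · simp [h.adj_inl_inl]
    · simp [h.adj_inl_inr, hv, hw]
  rw [deg, this, Set.ncard_image_of_injective _ Sum.inl_injective, deg]

end IsEarExtension

end SimpleGraph

/-- If `G ∈ 𝒢_A` has an edge `{v, w}` contained in no cycle and `n ∈ A`, then the graph
`H` obtained from `G` by adjoining a new internally disjoint path of length `n - 1` from
`v` to `w` (through `n - 2` new vertices) is again in `𝒢_A`. -/
theorem stmt10 (A : Set ℕ) (hA : A ⊆ {n | 3 ≤ n}) (hA2 : A.Nontrivial)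
    {V : Type} (G : SimpleGraph V) (hG : inGA A G)
    (v w : V) (hvw : G.Adj v w)
    (hnc : ∀ (u : V) (c : G.Walk u u), c.IsCycle → s(v, w) ∉ c.edges)
    (n : ℕ) (hn : n ∈ A)
    (H : SimpleGraph (V ⊕ Fin (n - 2)))
    (hHl : ∀ a b : V, H.Adj (Sum.inl a) (Sum.inl b) ↔ G.Adj a b)
    (hHm : ∀ (a : V) (i : Fin (n - 2)), H.Adj (Sum.inl a) (Sum.inr i) ↔
      ((a = v ∧ i.val = 0) ∨ (a = w ∧ i.val = n - 3)))
    (hHr : ∀ i j : Fin (n - 2), H.Adj (Sum.inr i) (Sum.inr j) ↔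
      (i.val + 1 = j.val ∨ j.val + 1 = i.val)) :
    inGA A H := by
  obtain ⟨hfin, hlen, hedge, hdeg⟩ := hG
  have h : G.IsEarExtension v w n H := ⟨hA hn, hHl, hHm, hHr⟩
  have hbr : G.IsBridge s(v, w) := (SimpleGraph.isBridge_iff_forall_cycle_notMem hvw).2 hnc
  refine ⟨inferInstance, ?_, ?_, ?_⟩
  · intro x c hc
    by_cases hi : ∃ i, Sum.inr i ∈ c.support
    · obtain ⟨i, hi⟩ := hi
      rwa [h.length_eq hvw.ne hbr hc hi]
    · obtain ⟨a, d, hd, hl, -⟩ := h.exists_isCycle_lift hc (not_exists.1 hi)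
      exact hl ▸ hlen a d hd
  · rintro x x' c c' hc hc' ⟨e, he, he'⟩
    by_cases hi : ∃ i, Sum.inr i ∈ c.support <;> by_cases hi' : ∃ i, Sum.inr i ∈ c'.support
    · obtain ⟨i, hi⟩ := hi
      obtain ⟨i', hi'⟩ := hi'
      intro f
      rw [h.mem_edges_iff hbr hc hi, h.mem_edges_iff hbr hc' hi']
    · obtain ⟨i, hi⟩ := hi
      exact absurd he' (h.notMem_edges_of_mem_edges hbr hnc hc hi hc' (not_exists.1 hi') he)
    · obtain ⟨i', hi'⟩ := hi'
      exact absurd he (h.notMem_edges_of_mem_edges hbr hnc hc' hi' hc (not_exists.1 hi) he')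
    · obtain ⟨a, d, hd, -, -, hde⟩ := h.exists_isCycle_lift hc (not_exists.1 hi)
      obtain ⟨a', d', hd', -, -, hde'⟩ := h.exists_isCycle_lift hc' (not_exists.1 hi')
      rw [hde, List.mem_map] at he
      rw [hde', List.mem_map] at he'
      obtain ⟨f, hf, rfl⟩ := he
      obtain ⟨f', hf', hff'⟩ := he'
      obtain rfl := Sym2.map.injective Sum.inl_injective hff'
      have key := hedge a a' d d' hd hd' ⟨f', hf, hf'⟩
      intro g
      simp only [hde, hde', List.mem_map, key]
  · intro x c hc
    by_cases hi : ∃ i, Sum.inr i ∈ c.support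
    · obtain ⟨i, hi⟩ := hi
      refine (Set.ncard_le_ncard (t := {Sum.inl v, Sum.inl w}) ?_).trans
        ((Set.ncard_insert_le _ _).trans (by simp))
      rintro y ⟨hy, hy2⟩
      rcases (h.mem_support_iff hbr hc hi y).1 hy with rfl | rfl | ⟨j, rfl⟩
      · simp
      · simp
      · exact absurd hy2 (h.deg_inr_le j).not_gt
    · obtain ⟨a, d, hd, -, hds, -⟩ := h.exists_isCycle_lift hc (not_exists.1 hi)
      refine le_trans ?_ (hdeg a d hd)
      rw [← Set.ncard_image_of_injective {u | u ∈ d.support ∧ 2 < deg G u}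
        (Sum.inl_injective (β := Fin (n - 2)))]
      refine Set.ncard_le_ncard ?_
      rintro y ⟨hy, hy2⟩
      rw [hds, List.mem_map] at hy
      obtain ⟨b, hb, rfl⟩ := hy
      refine ⟨b, ⟨hb, ?_⟩, rfl⟩
      by_cases hbv : b = v
      · subst hbv
        exact hd.two_lt_deg hb hvw (hnc a d hd)
      by_cases hbw : b = w
      · subst hbw
        exact hd.two_lt_deg hb hvw.symm (Sym2.eq_swap ▸ hnc a d hd)
      rwa [← h.deg_inl hbv hbw]
end
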